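/- arXiv:2004.01925 — 4 statements merged into one kernel-verified Lean document; each statement's English description precedes it below -/
import Mathlib

section
/- Let g ≥ 2 be a natural number, and let D be a digraph (finite, without loops or parallel arcs) whose digirth is at least 2g−1 and whose maximum degree (in the underlying graph) is Δ. Then the dichromatic number of D satisfies χ⃗(D) ≤ (1/3 + 1/(3g))·Δ + (g+1). -/
/-- A directed cycle in the digraph given by arc relation `A`: a nonempty list of
pairwise distinct vertices with consecutive arcs, and an arc from the last back
to the first vertex. Its length is the length of the list. -/
def IsDiCycle {V : Type*} (A : V → V → Prop) (l : List V) : Prop :=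
  l ≠ [] ∧ l.Nodup ∧ l.Chain' A ∧ ∀ h : l ≠ [], A (l.getLast h) (l.head h)

/-- A set of vertices is acyclic if it contains no directed cycle. -/
def AcyclicSet {V : Type*} (A : V → V → Prop) (X : Set V) : Prop :=
  ∀ l : List V, (∀ v ∈ l, v ∈ X) → ¬ IsDiCycle A l

/-- The dichromatic number: the least `n` admitting a coloring with `n` colors
all of whose color classes are acyclic. -/
noncomputable def dichromatic {V : Type*} (A : V → V → Prop) : ℕ :=
  sInf {n | ∃ f : V → Fin n, ∀ i : Fin n, AcyclicSet A {v | f v = i}}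

/-- Out-degree of a vertex. -/
noncomputable def outDeg {V : Type*} (A : V → V → Prop) (v : V) : ℕ :=
  {u | A v u}.ncard

/-- In-degree of a vertex. -/
noncomputable def inDeg {V : Type*} (A : V → V → Prop) (v : V) : ℕ :=
  {u | A u v}.ncard

/-- Degree of a vertex in the underlying undirected graph. -/
noncomputable def undirDeg {V : Type*} (A : V → V → Prop) (v : V) : ℕ :=
  {u | A v u ∨ A u v}.ncard

/-- Maximum degree of (the underlying graph of) the digraph. -/
noncomputable def maxDeg {V : Type*} [Fintype V] (A : V → V → Prop) : ℕ :=
  Finset.univ.sup (undirDeg A)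

/-- Maximum out-degree of the digraph. -/
noncomputable def maxOutDeg {V : Type*} [Fintype V] (A : V → V → Prop) : ℕ :=
  Finset.univ.sup (outDeg A)

/-- The digirth of the digraph is at least `γ`: every directed cycle has length at least `γ`.
(This is vacuously true for acyclic digraphs, whose digirth is `∞`.) -/
def digirthGE {V : Type*} (A : V → V → Prop) (γ : ℕ) : Prop :=
  ∀ l : List V, IsDiCycle A l → γ ≤ l.length

namespace Dicoloring

open Finset Function
open scoped Classical

section

variable {V K : Type*} {A : V → V → Prop}

/-- Adjacency in the underlying undirected graph. -/
def Adj (A : V → V → Prop) (u v : V) : Prop := A u v ∨ A v u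

lemma Adj.symm {u v : V} (h : Adj A u v) : Adj A v u := Or.symm h

lemma IsDiCycle.rotate {l : List V} (h : IsDiCycle A l) {w : V} (hw : w ∈ l) :
    ∃ l', IsDiCycle A (w :: l') ∧ (w :: l').Perm l := by
  obtain ⟨s, t, rfl⟩ := List.append_of_mem hw
  refine ⟨t ++ s, ?_, ?_⟩
  · obtain ⟨-, hnd, hch, hlast⟩ := h
    have hch' : List.IsChain A (s ++ w :: t) := hch
    have hl := hlast (by simp)
    refine ⟨by simp, ?_, ?_, ?_⟩
    · have : (w :: (t ++ s)).Perm (s ++ w :: t) := by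
        simpa using (List.perm_append_comm (l₁ := w :: t) (l₂ := s))
      exact this.nodup_iff.2 hnd
    · change List.IsChain A ((w :: t) ++ s)
      rw [List.isChain_append] at hch' ⊢
      refine ⟨hch'.2.1, hch'.1, ?_⟩
      intro x hx y hy
      rcases s with _ | ⟨a, s⟩
      · simp at hy
      · simp only [List.head?_cons, Option.mem_def, Option.some.injEq] at hy
        subst hy
        rw [List.getLast?_eq_getLast_of_ne_nil (by simp)] at hx
        simp only [Option.mem_def, Option.some.injEq] at hx
        subst hx
        simpa [List.getLast_append] using hl
    · intro _
      rcases List.eq_nil_or_concat s with rfl | ⟨s', a, rfl⟩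
      · simpa using hl
      · rw [List.isChain_append] at hch'
        have := hch'.2.2 a (by simp) w (by simp)
        rw [List.head_cons, List.getLast_congr (l₂ := (w :: (t ++ s')) ++ [a]) (by simp) (by simp)
          (by simp), List.getLast_append_singleton]
        exact this
  · simpa using (List.perm_append_comm (l₁ := w :: t) (l₂ := s))

lemma IsDiCycle.exists_succ {l : List V} (h : IsDiCycle A l) {v : V} (hv : v ∈ l) :
    ∃ s ∈ l, A v s := by
  obtain ⟨l', hl', hp⟩ := IsDiCycle.rotate h hv
  rcases l' with _ | ⟨b, l'⟩
  · exact ⟨v, hv, by simpa using hl'.2.2.2 (by simp)⟩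
  · have hch : List.IsChain A (v :: b :: l') := hl'.2.2.1
    exact ⟨b, hp.mem_iff.1 (by simp), (List.isChain_cons_cons.1 hch).1⟩

lemma IsDiCycle.exists_pred {l : List V} (h : IsDiCycle A l) {v : V} (hv : v ∈ l) :
    ∃ p ∈ l, A p v := by
  obtain ⟨l', hl', hp⟩ := IsDiCycle.rotate h hv
  exact ⟨_, hp.mem_iff.1 (List.getLast_mem (by simp)), hl'.2.2.2 (by simp)⟩

/-- `T` is a union of connected components of the monochromatic subgraph of `f`. -/
def CompClosed (A : V → V → Prop) (f : V → K) (T : Set V) : Prop :=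
  ∀ a ∈ T, ∀ b, Adj A a b → f b = f a → b ∈ T

lemma CompClosed.subset_of_chain {f : V → K} {T : Set V} (hT : CompClosed A f T) {c : K} :
    ∀ {l : List V}, l.IsChain A → (∀ v ∈ l, f v = c) → (∃ v ∈ l, v ∈ T) → ∀ v ∈ l, v ∈ T
  | [], _, _, _ => by simp
  | [a], _, _, h => by simpa using h
  | a :: b :: l, hch, hc, h => by
    rw [List.isChain_cons_cons] at hch
    have hab : f b = f a := by rw [hc b (by simp), hc a (by simp)]
    have ih := hT.subset_of_chain hch.2 (fun v hv => hc v (List.mem_cons_of_mem _ hv))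
    have hb : b ∈ T := by
      obtain ⟨v, hv, hvT⟩ := h
      rcases List.mem_cons.1 hv with rfl | hv
      · exact hT _ hvT _ (Or.inl hch.1) hab
      · exact ih ⟨v, hv, hvT⟩ b (by simp)
    intro v hv
    rcases List.mem_cons.1 hv with rfl | hv
    · exact hT b hb _ (Or.inr hch.1) hab.symm
    · exact ih ⟨b, by simp, hb⟩ v hv

variable [Fintype V]

/-- The neighbours of `v` that have colour `c`. -/
noncomputable def nbrs (A : V → V → Prop) (f : V → K) (v : V) (c : K) : Finset V :=
  {w | Adj A v w ∧ f w = c}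

@[simp] lemma mem_nbrs {f : V → K} {v w : V} {c : K} :
    w ∈ nbrs A f v c ↔ Adj A v w ∧ f w = c := by simp [nbrs]

/-- Twice the number of monochromatic edges. -/
noncomputable def monoDeg (A : V → V → Prop) (f : V → K) : ℕ := ∑ v, #(nbrs A f v (f v))

/-- `f` has the least possible number of monochromatic edges. -/
def MinColoring (A : V → V → Prop) (f : V → K) : Prop := ∀ f' : V → K, monoDeg A f ≤ monoDeg A f'

lemma exists_minColoring (A : V → V → Prop) [Nonempty K] : ∃ f : V → K, MinColoring A f := by
  obtain ⟨f, -, hf⟩ := WellFounded.has_min (measure (monoDeg (K := K) A)).wf Set.univ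
    ⟨fun _ => Classical.arbitrary K, trivial⟩
  exact ⟨f, fun f' => not_lt.1 (hf f' trivial)⟩

lemma monoDeg_eq (hirr : ∀ v, ¬ A v v) (f : V → K) (z : V) :
    monoDeg A f = (∑ v ∈ univ.erase z, ∑ w ∈ univ.erase z,
      if Adj A v w ∧ f w = f v then 1 else 0) + 2 * #(nbrs A f z (f z)) := by
  have key (v : V) : #(nbrs A f v (f v)) = ∑ w, if Adj A v w ∧ f w = f v then 1 else 0 := by
    rw [nbrs, Finset.card_filter]
  have hz : ¬ Adj A z z := fun h => h.elim (hirr z) (hirr z)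
  have h1 : ∑ v ∈ univ.erase z, (if Adj A v z ∧ f z = f v then 1 else 0)
      = #(nbrs A f z (f z)) := by
    rw [key, ← Finset.add_sum_erase univ _ (mem_univ z), if_neg (by tauto), zero_add]
    refine Finset.sum_congr rfl fun v _ => ?_
    congr 1
    exact propext ⟨fun h => ⟨h.1.symm, h.2.symm⟩, fun h => ⟨h.1.symm, h.2.symm⟩⟩
  rw [monoDeg, ← Finset.add_sum_erase univ _ (mem_univ z)]
  have h2 : ∑ v ∈ univ.erase z, #(nbrs A f v (f v)) =
      ∑ v ∈ univ.erase z, ((if Adj A v z ∧ f z = f v then 1 else 0) +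
        ∑ w ∈ univ.erase z, if Adj A v w ∧ f w = f v then 1 else 0) := by
    refine Finset.sum_congr rfl fun v _ => ?_
    rw [key, ← Finset.add_sum_erase univ _ (mem_univ z)]
  rw [h2, Finset.sum_add_distrib, h1]
  ring

lemma nbrs_update_self (hirr : ∀ v, ¬ A v v) (f : V → K) (z : V) (c c' : K) :
    nbrs A (update f z c) z c' = nbrs A f z c' := by
  ext w
  simp only [mem_nbrs]
  refine and_congr_right fun h => ?_
  rw [update_of_ne]
  rintro rfl
  exact h.elim (hirr _) (hirr _)

lemma monoDeg_update (hirr : ∀ v, ¬ A v v) (f : V → K) (z : V) (c : K) :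
    monoDeg A (update f z c) + 2 * #(nbrs A f z (f z)) = monoDeg A f + 2 * #(nbrs A f z c) := by
  rw [monoDeg_eq hirr f z, monoDeg_eq hirr (update f z c) z, update_self,
    nbrs_update_self hirr]
  have : (∑ v ∈ univ.erase z, ∑ w ∈ univ.erase z,
      if Adj A v w ∧ update f z c w = update f z c v then 1 else 0) =
      ∑ v ∈ univ.erase z, ∑ w ∈ univ.erase z, if Adj A v w ∧ f w = f v then 1 else 0 := by
    refine Finset.sum_congr rfl fun v hv => Finset.sum_congr rfl fun w hw => ?_
    rw [update_of_ne (ne_of_mem_erase hv), update_of_ne (ne_of_mem_erase hw)]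
  rw [this]
  ring

lemma MinColoring.own_le (hirr : ∀ v, ¬ A v v) {f : V → K} (hf : MinColoring A f) (v : V) (c : K) :
    #(nbrs A f v (f v)) ≤ #(nbrs A f v c) := by
  have := monoDeg_update hirr f v c
  have := hf (update f v c)
  omega

lemma MinColoring.update (hirr : ∀ v, ¬ A v v) {f : V → K} (hf : MinColoring A f) {v : V} {c : K}
    (h : #(nbrs A f v c) = #(nbrs A f v (f v))) : MinColoring A (update f v c) := by
  intro f'
  have := monoDeg_update hirr f v c
  have := hf f'
  omega

lemma sum_card_nbrs [Fintype K] (A : V → V → Prop) (f : V → K) (v : V) :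
    ∑ c, #(nbrs A f v c) = #{w | Adj A v w} := by
  rw [Finset.card_eq_sum_card_fiberwise (f := f) (t := univ) (by simp)]
  refine Finset.sum_congr rfl fun c _ => ?_
  rw [nbrs, Finset.filter_filter]

lemma MinColoring.card_mul_own_le [Fintype K] (hirr : ∀ v, ¬ A v v) {f : V → K} (hf : MinColoring A f)
    (v : V) : Fintype.card K * #(nbrs A f v (f v)) ≤ #{w | Adj A v w} := by
  rw [← sum_card_nbrs A f v, ← smul_eq_mul, ← Finset.card_univ, ← Finset.sum_const]
  exact Finset.sum_le_sum fun c _ => hf.own_le hirr v c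

end

section

variable {V K : Type*} {A : V → V → Prop}

/-- A directed cycle outside `S` all of whose vertices have colour `c`. -/
def MonoCycle (A : V → V → Prop) (S : Set V) (f : V → K) (c : K) (l : List V) : Prop :=
  IsDiCycle A l ∧ ∀ v ∈ l, f v = c ∧ v ∉ S

/-- The number of neighbours of `v` having the colour of `v`. -/
noncomputable abbrev own [Fintype V] (A : V → V → Prop) (f : V → K) (v : V) : ℕ :=
  #(nbrs A f v (f v))

/-- The colours other than that of `v` which occur exactly twice around `v`. -/
noncomputable def exactColors [Fintype V] [Fintype K] (A : V → V → Prop) (f : V → K) (v : V) : Finset K :=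
  {c | c ≠ f v ∧ #(nbrs A f v c) = 2}

@[simp] lemma mem_exactColors [Fintype V] [Fintype K] {f : V → K} {v : V} {c : K} :
    c ∈ exactColors A f v ↔ c ≠ f v ∧ #(nbrs A f v c) = 2 := by simp [exactColors]

/-- A digraph of small degree and large girth, such that every minimum colouring has a
monochromatic directed cycle avoiding `S`. -/
structure Obstruction [Fintype V] (A : V → V → Prop) (K : Type*) [Fintype K] (g : ℕ)
    (S : Set V) : Prop where
  irr : ∀ v, ¬ A v v
  two_le : 2 ≤ g
  card_eq : Fintype.card K = g + 1
  deg_le : ∀ v, #{w | Adj A v w} + 1 ≤ 3 * g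
  girth : ∀ l, IsDiCycle A l → 2 * g ≤ l.length + 1
  exists_cycle : ∀ f : V → K, MinColoring A f → ∃ c l, MonoCycle A S f c l

/-- A minimum colouring all of whose monochromatic cycles outside `S` pass through `u`. -/
structure Pivot [Fintype V] (A : V → V → Prop) (S : Set V) (f : V → K) (u : V) : Prop where
  min : MinColoring A f
  mem : ∀ c l, MonoCycle A S f c l → u ∈ l

variable [Fintype V] [Fintype K] {g : ℕ} {S : Set V} {f : V → K} {u v w z : V} {c : K} {l : List V}

namespace Obstruction

variable (h : Obstruction A K g S)
include h

lemma asymm (huv : A u v) : ¬ A v u := by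
  intro hvu
  have hne : u ≠ v := by rintro rfl; exact h.irr _ huv
  have : IsDiCycle A [u, v] := by
    refine ⟨by simp, by simpa using hne, ?_, by simpa using hvu⟩
    exact List.isChain_pair.2 huv
  have := h.girth _ this
  have := h.two_le
  simp at *
  omega

lemma ne_of_adj (huv : Adj A u v) : u ≠ v := by
  rintro rfl
  exact huv.elim (h.irr _) (h.irr _)

lemma own_le_two (hf : MinColoring A f) (v : V) : #(nbrs A f v (f v)) ≤ 2 := by
  have h1 := hf.card_mul_own_le h.irr v
  rw [h.card_eq] at h1
  have h2 := h.deg_le v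
  by_contra! h3
  nlinarith

lemma three_le_card_exactColors (hf : MinColoring A f) (hv : own A f v = 2) : 3 ≤ #(exactColors A f v) := by
  rw [own] at hv
  have h1 := sum_card_nbrs A f v
  rw [← Finset.add_sum_erase univ _ (mem_univ (f v))] at h1
  have h2 := h.deg_le v
  have h3 : ∑ c ∈ univ.erase (f v), 3 ≤
      ∑ c ∈ univ.erase (f v), (#(nbrs A f v c) + if #(nbrs A f v c) = 2 then 1 else 0) := by
    refine Finset.sum_le_sum fun c _ => ?_
    have := hf.own_le h.irr v c
    split_ifs <;> omega
  rw [Finset.sum_add_distrib, ← Finset.card_filter, Finset.sum_const, smul_eq_mul,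
    Finset.card_erase_of_mem (mem_univ _), Finset.card_univ, h.card_eq] at h3
  have h4 : (univ.erase (f v)).filter (fun c => #(nbrs A f v c) = 2) = exactColors A f v := by
    ext c; simp
  rw [h4] at h3
  omega

lemma own_le_one (hf : MinColoring A f) (hz : own A f z = 2) (hc : c ∈ exactColors A f z)
    (hzw : Adj A z w) (hw : f w = c) : own A f w ≤ 1 := by
  rw [mem_exactColors] at hc
  have hmin := hf.update h.irr (hc.2.trans hz.symm)
  have hne : w ≠ z := (h.ne_of_adj hzw).symm
  have h2 := h.own_le_two hmin w
  rw [update_of_ne hne, hw] at h2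
  have hsub : insert z (nbrs A f w c) ⊆ nbrs A (update f z c) w c := by
    intro x hx
    rcases mem_insert.1 hx with rfl | hx
    · simp [hzw.symm]
    · rw [mem_nbrs] at hx ⊢
      refine ⟨hx.1, ?_⟩
      rw [update_apply]
      split_ifs
      exacts [rfl, hx.2]
  have h3 := Finset.card_le_card hsub
  rw [Finset.card_insert_of_notMem (by simp [hc.1.symm])] at h3
  rw [own, hw]
  omega

lemma nbrs_eq_pair (hf : MinColoring A f) (hl : MonoCycle A S f c l) (hv : v ∈ l) :
    ∃ p ∈ l, ∃ s ∈ l, A p v ∧ A v s ∧ p ≠ s ∧ nbrs A f v c = {p, s} := by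
  obtain ⟨p, hp, hpv⟩ := IsDiCycle.exists_pred hl.1 hv
  obtain ⟨s, hs, hvs⟩ := IsDiCycle.exists_succ hl.1 hv
  have hps : p ≠ s := by rintro rfl; exact h.asymm hpv hvs
  refine ⟨p, hp, s, hs, hpv, hvs, hps, ?_⟩
  have h2 := h.own_le_two hf v
  rw [(hl.2 v hv).1] at h2
  refine (Finset.eq_of_subset_of_card_le ?_ ?_).symm
  · intro x hx
    rcases mem_insert.1 hx with rfl | hx
    · exact mem_nbrs.2 ⟨Or.inr hpv, (hl.2 _ hp).1⟩
    · rw [mem_singleton] at hx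
      subst hx
      exact mem_nbrs.2 ⟨Or.inl hvs, (hl.2 _ hs).1⟩
  · rwa [Finset.card_pair hps]

lemma own_of_mem (hf : MinColoring A f) (hl : MonoCycle A S f c l) (hv : v ∈ l) :
    own A f v = 2 := by
  obtain ⟨p, -, s, -, -, -, hps, he⟩ := h.nbrs_eq_pair hf hl hv
  rw [own, (hl.2 v hv).1, he, Finset.card_pair hps]

lemma compClosed (hf : MinColoring A f) (hl : MonoCycle A S f c l) :
    CompClosed A f {v | v ∈ l} := by
  intro a ha b hab hfb
  obtain ⟨p, hp, s, hs, -, -, -, he⟩ := h.nbrs_eq_pair hf hl ha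
  have : b ∈ nbrs A f a c := mem_nbrs.2 ⟨hab, hfb.trans (hl.2 a ha).1⟩
  rw [he] at this
  simp only [mem_insert, mem_singleton] at this
  rcases this with rfl | rfl <;> assumption

lemma pivot_of_mem (hu : Pivot A S f u) (hl : MonoCycle A S f c l) (hz : z ∈ l) :
    Pivot A S f z := by
  refine ⟨hu.min, fun c' l' hl' => ?_⟩
  exact (h.compClosed hu.min hl').subset_of_chain hl.1.2.2.1 (fun v hv => (hl.2 v hv).1)
    ⟨u, hu.mem _ _ hl, hu.mem _ _ hl'⟩ z hz

lemma exists_cycle_cons (hu : Pivot A S f u) : ∃ l, MonoCycle A S f (f u) (u :: l) := by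
  obtain ⟨c, l, hl⟩ := h.exists_cycle f hu.min
  have hul := hu.mem _ _ hl
  obtain ⟨l', hl', hp⟩ := IsDiCycle.rotate hl.1 hul
  refine ⟨l', hl', fun v hv => ?_⟩
  rw [(hl.2 u hul).1]
  exact hl.2 v (hp.mem_iff.1 hv)

lemma pivot_own (hu : Pivot A S f u) : own A f u = 2 := by
  obtain ⟨l, hl⟩ := h.exists_cycle_cons hu
  exact h.own_of_mem hu.min hl (by simp)

lemma pivot_update (hz : Pivot A S f z) (hc : c ∈ exactColors A f z) : Pivot A S (update f z c) z := by
  have h2 := h.pivot_own hz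
  refine ⟨hz.min.update h.irr ((mem_exactColors.1 hc).2.trans h2.symm), fun c' l hl => ?_⟩
  by_contra hzl
  refine hzl (hz.mem c' l ⟨hl.1, fun v hv => ?_⟩)
  have hvz : v ≠ z := by rintro rfl; exact hzl hv
  simpa [hvz] using hl.2 v hv

lemma exists_cycle_update (hz : Pivot A S f z) (hc : c ∈ exactColors A f z) :
    ∃ l, MonoCycle A S (update f z c) c (z :: l) := by
  simpa using h.exists_cycle_cons (h.pivot_update hz hc)

end Obstruction
end

section

variable {V K : Type*} {A : V → V → Prop}

lemma CompClosed.compl {f : V → K} {T : Set V} (hT : CompClosed A f T) : CompClosed A f Tᶜ :=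
  fun a ha b hab hfb hb => ha (hT b hb a hab.symm hfb.symm)

lemma exists_pred_of_isChain : ∀ {a : V} {l : List V}, (a :: l).IsChain A → ∀ v ∈ l,
    ∃ p ∈ a :: l, A p v
  | _, [], _ => by simp
  | a, b :: l, h => by
    rw [List.isChain_cons_cons] at h
    intro v hv
    rcases List.mem_cons.1 hv with rfl | hv
    · exact ⟨a, by simp, h.1⟩
    · obtain ⟨p, hp, hpv⟩ := exists_pred_of_isChain h.2 v hv
      exact ⟨p, List.mem_cons_of_mem _ hp, hpv⟩

/-- The colouring `f` arises from `f₀` by giving some of the vertices `m y` with `y ∈ Y` the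
colour of `y`, these vertices lying in distinct components of the monochromatic subgraph
of `f₀`. -/
structure Shift (A : V → V → Prop) (f₀ : V → K) (Y : Finset V) (m : V → V) (f : V → K) : Prop where
  moved : ∀ v, f v ≠ f₀ v → ∃ y ∈ Y, m y = v ∧ f v = f₀ y
  sep : ∀ v v', v ≠ v' → f v ≠ f₀ v → f v' ≠ f₀ v' → ∃ T, CompClosed A f₀ T ∧ v ∈ T ∧ v' ∉ T

lemma Shift.refl (f₀ : V → K) (Y : Finset V) (m : V → V) : Shift A f₀ Y m f₀ :=
  ⟨fun _ h => (h rfl).elim, fun _ _ _ h => (h rfl).elim⟩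

lemma Shift.mono_insert {f₀ f : V → K} {Y : Finset V} {m : V → V} (hs : Shift A f₀ Y m f) {y : V}
    (hy : y ∉ Y) (w : V) : Shift A f₀ (insert y Y) (update m y w) f := by
  refine ⟨fun v hv => ?_, hs.sep⟩
  obtain ⟨y', hy', h1, h2⟩ := hs.moved v hv
  refine ⟨y', mem_insert_of_mem hy', ?_, h2⟩
  rw [update_of_ne, h1]
  rintro rfl
  exact hy hy'

lemma Shift.update_insert {f₀ f : V → K} {Y : Finset V} {m : V → V} (hs : Shift A f₀ Y m f) {y w : V}
    (hy : y ∉ Y) (hw : ∀ v, f v ≠ f₀ v → ∃ T, CompClosed A f₀ T ∧ w ∈ T ∧ v ∉ T) :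
    Shift A f₀ (insert y Y) (update m y w) (update f w (f₀ y)) := by
  have hold := hs.mono_insert hy w
  refine ⟨fun v hv => ?_, fun v v' hne hv hv' => ?_⟩
  · rcases eq_or_ne v w with rfl | hvw
    · exact ⟨y, by simp⟩
    · rw [update_of_ne hvw] at hv ⊢
      exact hold.moved v hv
  · rcases eq_or_ne v w with rfl | hvw
    · rw [update_of_ne hne.symm] at hv'
      exact hw _ hv'
    · rw [update_of_ne hvw] at hv
      rcases eq_or_ne v' w with rfl | hvw'
      · obtain ⟨T, hT, h1, h2⟩ := hw _ hv
        exact ⟨Tᶜ, hT.compl, h2, fun h => h h1⟩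
      · rw [update_of_ne hvw'] at hv'
        exact hs.sep v v' hne hv hv'

variable [Fintype V] [Fintype K]

/-- A family of cycles `m y :: y :: L y`, for `y ∈ Y`, such that `m y :: y :: L y` is
monochromatic in the colouring `F y`, and `y :: L y` is monochromatic in `f₀`. -/
structure Config (A : V → V → Prop) (S : Set V) (f₀ : V → K) (Y : Finset V) (m : V → V)
    (F : V → V → K) (L : V → List V) : Prop where
  pivot : ∀ y ∈ Y, Pivot A S (F y) (m y)
  shift : ∀ y ∈ Y, Shift A f₀ Y m (F y)
  own_eq : ∀ y ∈ Y, own A f₀ (m y) = 2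
  mem_exactColors : ∀ y ∈ Y, f₀ y ∈ exactColors A f₀ (m y)
  cycle : ∀ y ∈ Y, MonoCycle A S (F y) (f₀ y) (m y :: y :: L y)
  base : ∀ y ∈ Y, ∀ v ∈ y :: L y, f₀ v = f₀ y

variable {g : ℕ} {S : Set V} {f₀ : V → K} {Y : Finset V} {m : V → V}
  {F : V → V → K} {L : V → List V} {y y' v w : V} {c : K} {fs : V → K}

namespace Config

variable (C : Config A S f₀ Y m F L) (h : Obstruction A K g S) (hf₀ : MinColoring A f₀)
include C

lemma ne_of_mem (hy : y ∈ Y) (hv : v ∈ y :: L y) : v ≠ m y := by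
  rintro rfl
  exact (List.nodup_cons.1 (C.cycle y hy).1.2.1).1 hv

lemma adj_head (hy : y ∈ Y) : A (m y) y :=
  (List.isChain_cons_cons.1 (C.cycle y hy).1.2.2.1).1

lemma isChain (hy : y ∈ Y) : (y :: L y).IsChain A :=
  (List.isChain_cons_cons.1 (C.cycle y hy).1.2.2.1).2

lemma monoCycle (hy : y ∈ Y) : MonoCycle A S (update f₀ (m y) (f₀ y)) (f₀ y) (m y :: y :: L y) := by
  refine ⟨(C.cycle y hy).1, fun v hv => ⟨?_, ((C.cycle y hy).2 v hv).2⟩⟩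
  rcases List.mem_cons.1 hv with rfl | hv
  · simp
  · rw [update_of_ne (C.ne_of_mem hy hv), C.base y hy v hv]

lemma own_of_moved (hs : Shift A f₀ Y m fs) (hv : fs v ≠ f₀ v) :
    own A f₀ v = 2 ∧ fs v ∈ exactColors A f₀ v := by
  obtain ⟨y, hy, rfl, hc⟩ := hs.moved v hv
  exact ⟨C.own_eq y hy, hc ▸ C.mem_exactColors y hy⟩

include h

lemma two_mul_le_length (hy : y ∈ Y) : 2 * g ≤ (L y).length + 3 := by
  have := h.girth _ (C.cycle y hy).1
  simpa using this

lemma exists_adj (hy : y ∈ Y) : ∃ b ∈ y :: L y, A y b := by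
  have h1 := C.two_mul_le_length h hy
  have h2 := h.two_le
  have h3 := C.isChain hy
  rcases hL : L y with _ | ⟨b, l⟩
  · rw [hL] at h1
    simp at h1
    omega
  · rw [hL, List.isChain_cons_cons] at h3
    exact ⟨b, by simp, h3.1⟩

include hf₀

lemma minColoring_update (hy : y ∈ Y) : MinColoring A (update f₀ (m y) (f₀ y)) :=
  hf₀.update h.irr ((Dicoloring.mem_exactColors.1 (C.mem_exactColors y hy)).2.trans (C.own_eq y hy).symm)

lemma compClosed (hy : y ∈ Y) : CompClosed A f₀ {v | v ∈ y :: L y} := by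
  intro a ha b hab hfb
  have ham : a ≠ m y := C.ne_of_mem hy ha
  have hbc : f₀ b = f₀ y := hfb.trans (C.base y hy a ha)
  have hbm : b ≠ m y := by
    rintro rfl
    exact (Dicoloring.mem_exactColors.1 (C.mem_exactColors y hy)).1 hbc.symm
  have := h.compClosed (C.minColoring_update h hf₀ hy) (C.monoCycle hy) a
    (List.mem_cons_of_mem _ ha) b hab (by rwa [update_of_ne ham, update_of_ne hbm])
  exact (List.mem_cons.1 this).resolve_left hbm

lemma own_le_one_of_adj (hy : y ∈ Y) (hv : Adj A (m y) v) (hvy : f₀ v = f₀ y) : own A f₀ v ≤ 1 :=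
  h.own_le_one hf₀ (C.own_eq y hy) (C.mem_exactColors y hy) hv hvy

lemma eq_of_mem (hy : y ∈ Y) (hy' : y' ∈ Y) (hv : v ∈ y :: L y) (hv' : v ∈ y' :: L y') :
    y = y' := by
  have hmem : y' ∈ y :: L y :=
    (C.compClosed h hf₀ hy).subset_of_chain (C.isChain hy') (C.base y' hy') ⟨v, hv', hv⟩ y' (by simp)
  rcases List.mem_cons.1 hmem with heq | hmem'
  · exact heq.symm
  obtain ⟨p, hp, hpy⟩ := exists_pred_of_isChain (C.isChain hy) y' hmem'
  obtain ⟨b, hb, hyb⟩ := C.exists_adj h hy'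
  have hpb : p ≠ b := by rintro rfl; exact h.asymm hpy hyb
  have h1 := C.own_le_one_of_adj h hf₀ hy' (Or.inl (C.adj_head hy')) rfl
  have h2 : ({p, b} : Finset V) ⊆ nbrs A f₀ y' (f₀ y') := by
    intro x hx
    rcases mem_insert.1 hx with rfl | hx
    · exact mem_nbrs.2 ⟨Or.inr hpy, (C.base y hy _ hp).trans (C.base y hy _ hmem).symm⟩
    · rw [mem_singleton] at hx
      subst hx
      exact mem_nbrs.2 ⟨Or.inl hyb, C.base y' hy' _ hb⟩
  have h3 := Finset.card_le_card h2
  rw [Finset.card_pair hpb] at h3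
  rw [own] at h1
  omega

lemma not_moved (hg : 3 ≤ g) (hs : Shift A f₀ Y m fs) (hw : fs w = f₀ w) (hw2 : own A f₀ w = 2)
    (hc : c ∈ exactColors A f₀ w) (hmin : MinColoring A (update fs w c)) {l : List V}
    (hl : MonoCycle A S (update fs w c) c (w :: l)) : ∀ v ∈ l, fs v = f₀ v := by
  by_contra! hcon
  obtain ⟨x, hxl, hx⟩ := hcon
  have hxw : x ≠ w := by
    rintro rfl
    exact hx hw
  have hwc : f₀ w ≠ c := (Dicoloring.mem_exactColors.1 hc).1.symm
  have hxc : fs x = c := by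
    simpa [hxw] using (hl.2 x (List.mem_cons_of_mem _ hxl)).1
  obtain ⟨y, hy, rfl, hxy⟩ := hs.moved x hx
  obtain rfl : f₀ y = c := hxy.symm.trans hxc
  set f' := update fs w (f₀ y) with hf'
  have hf'_ne {v} (hv : v ≠ w) : f' v = fs v := update_of_ne hv _ _
  have hLw : ∀ v ∈ y :: L y, v ≠ w := by
    rintro v hv rfl
    exact hwc (C.base y hy v hv)
  have hNS : ∀ v ∈ m y :: y :: L y, v ∉ S := fun v hv => ((C.cycle y hy).2 v hv).2
  have hZ := h.compClosed hmin hl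
  have hcol : ∀ v ∈ m y :: y :: L y, (v ∈ y :: L y → fs v = f₀ v) → f' v = f₀ y := by
    intro v hv hv'
    rcases List.mem_cons.1 hv with rfl | hv
    · rw [hf'_ne hxw, hxc]
    · rw [hf'_ne (hLw v hv), hv' hv, C.base y hy v hv]
  by_cases hall : ∀ v ∈ y :: L y, fs v = f₀ v
  · have hN : MonoCycle A S f' (f₀ y) (m y :: y :: L y) :=
      ⟨(C.cycle y hy).1, fun v hv => ⟨hcol v hv (hall v), hNS v hv⟩⟩
    have hwN : w ∈ m y :: y :: L y :=
      (h.compClosed hmin hN).subset_of_chain hl.1.2.2.1 (fun v hv => (hl.2 v hv).1)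
        ⟨m y, List.mem_cons_of_mem _ hxl, by simp⟩ w (by simp)
    rcases List.mem_cons.1 hwN with heq | hwN
    · exact hxw heq.symm
    · exact hLw w hwN rfl
  push Not at hall
  obtain ⟨q, hqL, hq⟩ := hall
  have hqc := C.base y hy q hqL
  have huniq : ∀ v ∈ y :: L y, v ≠ q → fs v = f₀ v := by
    intro v hv hvq
    by_contra hvm
    obtain ⟨T, hT, hqT, hvT⟩ := hs.sep q v hvq.symm hq hvm
    exact hvT (hT.subset_of_chain (C.isChain hy) (C.base y hy) ⟨q, hqL, hqT⟩ v hv)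
  obtain ⟨hq2, -⟩ := C.own_of_moved hs hq
  obtain ⟨R, hR, hperm⟩ := IsDiCycle.rotate (C.cycle y hy).1 (List.mem_cons_of_mem (m y) hqL)
  have hRsub : ∀ v ∈ R, v ∈ w :: l := by
    have hxq : m y ≠ q := (C.ne_of_mem hy hqL).symm
    have hch : R.IsChain A := by
      have : (q :: R).IsChain A := hR.2.2.1
      exact this.tail
    refine hZ.subset_of_chain hch (c := f₀ y) (fun v hv => ?_) ⟨m y, ?_, by simp [hxl]⟩
    · refine hcol v (hperm.mem_iff.1 (List.mem_cons_of_mem _ hv)) fun hvL => huniq v hvL ?_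
      rintro rfl
      exact (List.nodup_cons.1 hR.2.1).1 hv
    · have : m y ∈ q :: R := hperm.mem_iff.2 (by simp)
      exact (List.mem_cons.1 this).resolve_left hxq
  have hmemR : ∀ v ∈ m y :: y :: L y, v ≠ q → v ∈ R := fun v hv hvq =>
    (List.mem_cons.1 (hperm.mem_iff.2 hv)).resolve_left hvq
  have hnb : ∀ v ∈ m y :: y :: L y, Adj A q v → v ∈ y :: L y ∧ own A f₀ v ≤ 1 := by
    intro v hv hqv
    have hvq : v ≠ q := (h.ne_of_adj hqv).symm
    have hvL : v ∈ y :: L y := by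
      refine (List.mem_cons.1 hv).resolve_left ?_
      rintro rfl
      have := C.own_le_one_of_adj h hf₀ hy hqv.symm hqc
      omega
    refine ⟨hvL, ?_⟩
    have hvZ := hRsub v (hmemR v hv hvq)
    have hv2 := h.own_of_mem hmin hl hvZ
    rw [own, (hl.2 v hvZ).1] at hv2
    have hvc := C.base y hy v hvL
    by_contra! hlow
    have hle := h.own_le_two hf₀ v
    have hf'q : f' q ≠ f₀ y := by
      rw [hf'_ne (hLw q hqL), ← hqc]
      exact hq
    have : ∃ t ∈ nbrs A f' v (f₀ y), f₀ t ≠ f₀ y := by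
      by_contra! hall
      have hsub : nbrs A f' v (f₀ y) ⊆ (nbrs A f₀ v (f₀ y)).erase q := by
        intro t ht
        have ht' := mem_nbrs.1 ht
        refine mem_erase.2 ⟨?_, mem_nbrs.2 ⟨ht'.1, hall t ht⟩⟩
        rintro rfl
        exact hf'q ht'.2
      have hcard := Finset.card_le_card hsub
      rw [Finset.card_erase_of_mem (mem_nbrs.2 ⟨hqv.symm, hqc⟩)] at hcard
      rw [hvc] at hle
      omega
    obtain ⟨t, ht, htc⟩ := this
    rw [mem_nbrs] at ht
    have ht' : own A f₀ t = 2 ∧ f₀ y ∈ exactColors A f₀ t := by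
      rcases eq_or_ne t w with rfl | htw
      · exact ⟨hw2, hc⟩
      · rw [hf'_ne htw] at ht
        have := C.own_of_moved hs (v := t) (by rw [ht.2]; exact htc.symm)
        rwa [ht.2] at this
    have := h.own_le_one hf₀ ht'.1 ht'.2 ht.1.symm hvc
    omega
  obtain ⟨p, hp, hpq⟩ := IsDiCycle.exists_pred (C.cycle y hy).1 (List.mem_cons_of_mem (m y) hqL)
  obtain ⟨s, hs', hqs⟩ := IsDiCycle.exists_succ (C.cycle y hy).1 (List.mem_cons_of_mem (m y) hqL)
  have hps : p ≠ s := by rintro rfl; exact h.asymm hpq hqs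
  obtain ⟨hpL, hp1⟩ := hnb p hp (Or.inr hpq)
  obtain ⟨hsL, hs1⟩ := hnb s hs' (Or.inl hqs)
  have hnq : nbrs A f₀ q (f₀ q) = {p, s} := by
    refine (Finset.eq_of_subset_of_card_le ?_ ?_).symm
    · intro x hx
      rcases mem_insert.1 hx with rfl | hx
      · exact mem_nbrs.2 ⟨Or.inr hpq, (C.base y hy _ hpL).trans hqc.symm⟩
      · rw [mem_singleton] at hx
        subst hx
        exact mem_nbrs.2 ⟨Or.inl hqs, (C.base y hy _ hsL).trans hqc.symm⟩
    · rw [Finset.card_pair hps]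
      exact hq2.le
  have hleaf : ∀ a ∈ y :: L y, Adj A q a → own A f₀ a ≤ 1 → ∀ b, Adj A a b → f₀ b = f₀ a →
      b = q := by
    intro a ha hqa ha1 b hab hb
    exact Finset.card_le_one.1 ha1 b (mem_nbrs.2 ⟨hab, hb⟩) q
      (mem_nbrs.2 ⟨hqa.symm, hqc.trans (C.base y hy a ha).symm⟩)
  have hclosed : CompClosed A f₀ {v | v = p ∨ v = q ∨ v = s} := by
    rintro a (rfl | rfl | rfl) b hab hb
    · exact Or.inr (Or.inl (hleaf _ hpL (Or.inr hpq) hp1 b hab hb))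
    · have : b ∈ nbrs A f₀ a (f₀ a) := mem_nbrs.2 ⟨hab, hb⟩
      rw [hnq] at this
      simp only [mem_insert, mem_singleton] at this
      simp only [Set.mem_ofPred_eq]
      tauto
    · exact Or.inr (Or.inl (hleaf _ hsL (Or.inl hqs) hs1 b hab hb))
  have hsub : (y :: L y).toFinset ⊆ {p, q, s} := by
    intro v hv
    have := hclosed.subset_of_chain (C.isChain hy) (C.base y hy) ⟨q, hqL, by simp⟩ v
      (List.mem_toFinset.1 hv)
    simpa using this
  have hcard := Finset.card_le_card hsub
  rw [List.toFinset_card_of_nodup (List.nodup_cons.1 (C.cycle y hy).1.2.1).2] at hcard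
  have hlen := C.two_mul_le_length h hy
  have h3 : #({p, q, s} : Finset V) ≤ 3 := Finset.card_le_three
  simp only [List.length_cons] at hcard
  omega

end Config
end

section

variable {V K : Type*} {A : V → V → Prop} [Fintype V] [Fintype K]
variable {g : ℕ} {S : Set V} {f₀ : V → K} {Y : Finset V} {m : V → V}
  {F : V → V → K} {L : V → List V} {y y' v w : V} {c : K} {fs : V → K}

namespace Config

/-- The vertices of `y :: L y` not adjacent to `m y`. -/
noncomputable def inner (A : V → V → Prop) (m : V → V) (L : V → List V) (y : V) : Finset V :=
  {w ∈ (y :: L y).toFinset | ¬ Adj A (m y) w}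

omit [Fintype V] in
lemma mem_inner : w ∈ inner A m L y ↔ w ∈ y :: L y ∧ ¬ Adj A (m y) w := by
  simp [inner]

/-- The neighbours of `m y` which have two neighbours of their own colour, this colour
being different from that of `m y`. -/
noncomputable def bad (A : V → V → Prop) (f₀ : V → K) (m : V → V) (y : V) : Finset V :=
  {w | Adj A (m y) w ∧ f₀ w ≠ f₀ (m y) ∧ own A f₀ w = 2}

variable (C : Config A S f₀ Y m F L) (h : Obstruction A K g S) (hf₀ : MinColoring A f₀)
include C h

lemma le_card_inner (hy : y ∈ Y) : 2 * g ≤ #(inner A m L y) + 4 := by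
  have h1 := C.two_mul_le_length h hy
  have h2 : (y :: L y).toFinset ⊆ inner A m L y ∪ nbrs A f₀ (m y) (f₀ y) := by
    intro v hv
    rw [mem_union, mem_inner, mem_nbrs]
    rw [List.mem_toFinset] at hv
    by_cases hmv : Adj A (m y) v
    exacts [Or.inr ⟨hmv, C.base y hy v hv⟩, Or.inl ⟨hv, hmv⟩]
  have h3 := (Finset.card_le_card h2).trans (Finset.card_union_le _ _)
  rw [List.toFinset_card_of_nodup (List.nodup_cons.1 (C.cycle y hy).1.2.1).2,
    (Dicoloring.mem_exactColors.1 (C.mem_exactColors y hy)).2] at h3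
  simp only [List.length_cons] at h3
  omega

lemma four_le_card_out (hy : y ∈ Y) : 4 ≤ #{w | A y w} := by
  have hp : Pivot A S (F y) y := h.pivot_of_mem (C.pivot y hy) (C.cycle y hy) (by simp)
  have h3 := h.three_le_card_exactColors hp.min (h.pivot_own hp)
  have hsub : insert (F y y) (exactColors A (F y) y) ⊆ image (F y) {w | A y w} := by
    intro c hc
    have : ∃ f l, MonoCycle A S f c (y :: l) ∧ ∀ v, v ≠ y → f v = F y v := by
      rcases mem_insert.1 hc with rfl | hc
      · obtain ⟨l, hl⟩ := h.exists_cycle_cons hp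
        exact ⟨_, l, hl, fun _ _ => rfl⟩
      · obtain ⟨l, hl⟩ := h.exists_cycle_update hp hc
        exact ⟨_, l, hl, fun v hv => update_of_ne hv _ _⟩
    obtain ⟨f, l, hl, hf⟩ := this
    obtain ⟨s, hs, hys⟩ := IsDiCycle.exists_succ hl.1 (List.mem_cons_self (a := y) (l := l))
    have hsy : s ≠ y := (h.ne_of_adj (Or.inl hys)).symm
    exact mem_image.2 ⟨s, by simpa using hys, by rw [← hf s hsy, (hl.2 s hs).1]⟩
  have h4 := (Finset.card_le_card hsub).trans Finset.card_image_le
  rw [card_insert_of_notMem (by simp)] at h4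
  omega

lemma card_in_le (hy : y ∈ Y) : #{w | A w y} + 5 ≤ 3 * g := by
  have h1 := C.four_le_card_out h hy
  have h2 := h.deg_le y
  have h3 : Disjoint ({w | A y w} : Finset V) ({w | A w y} : Finset V) := by
    rw [Finset.disjoint_left]
    intro w hw hw'
    simp only [mem_filter, mem_univ, true_and] at hw hw'
    exact h.asymm hw hw'
  have h4 : ({w | A y w} : Finset V) ∪ ({w | A w y} : Finset V) = ({w | Adj A y w} : Finset V) := by
    ext w
    simp only [mem_union, mem_filter, mem_univ, true_and]
    rfl
  rw [← h4, card_union_of_disjoint h3] at h2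
  omega

include hf₀

lemma exists_mem_of_maximal (hg : 3 ≤ g)
    (hmax : ∀ Y' m' F' L', Config A S f₀ Y' m' F' L' → #Y' ≤ #Y)
    (hs : Shift A f₀ Y m fs) (hp : Pivot A S fs w) (hw : fs w = f₀ w) (hw2 : own A f₀ w = 2)
    (hsep : ∀ v, fs v ≠ f₀ v → ∃ T, CompClosed A f₀ T ∧ w ∈ T ∧ v ∉ T)
    (hc : c ∈ exactColors A f₀ w) (hnb : ∀ v, Adj A w v → fs v = c → f₀ v = c) :
    ∃ y ∈ Y, f₀ y = c ∧ A w y := by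
  have hnbrs : nbrs A fs w c = nbrs A f₀ w c := by
    ext v
    simp only [mem_nbrs]
    refine and_congr_right fun hv => ⟨hnb v hv, fun hvc => ?_⟩
    by_contra hne
    have h1 := C.own_of_moved hs (v := v) (by rwa [hvc])
    have h2 := h.own_le_one hf₀ hw2 hc hv hvc
    omega
  have hc' : c ∈ exactColors A fs w := by
    rw [Dicoloring.mem_exactColors, hw, hnbrs]
    exact Dicoloring.mem_exactColors.1 hc
  obtain ⟨l, hl⟩ := h.exists_cycle_update hp hc'
  have hp' := h.pivot_update hp hc'
  have hun := C.not_moved h hf₀ hg hs hw hw2 hc hp'.min hl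
  have hlen := h.girth _ hl.1
  have hcol : ∀ v ∈ l, f₀ v = c := by
    intro v hv
    have hvw : v ≠ w := by
      rintro rfl
      exact (List.nodup_cons.1 hl.1.2.1).1 hv
    rw [← hun v hv]
    simpa [hvw] using (hl.2 v (List.mem_cons_of_mem _ hv)).1
  rcases l with _ | ⟨x, l⟩
  · simp only [List.length_cons, List.length_nil] at hlen
    omega
  have hwx : A w x := by
    have : (w :: x :: l).IsChain A := hl.1.2.2.1
    exact (List.isChain_cons_cons.1 this).1
  obtain rfl : f₀ x = c := hcol x (by simp)
  by_contra! hcon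
  have hxY : x ∉ Y := fun hx => hcon x hx rfl hwx
  have hne : ∀ y ∈ Y, y ≠ x := by
    rintro y hy rfl
    exact hxY hy
  have hC : Config A S f₀ (insert x Y) (update m x w) (update F x (update fs w (f₀ x)))
      (update L x l) := by
    constructor <;> intro y hy <;> rcases mem_insert.1 hy with rfl | hy
    · simpa using hp'
    · simpa [hne y hy] using C.pivot y hy
    · simpa using hs.update_insert hxY hsep
    · simpa [hne y hy] using (C.shift y hy).mono_insert hxY w
    · simpa using hw2
    · simpa [hne y hy] using C.own_eq y hy
    · simpa only [update_self] using hc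
    · simpa only [update_of_ne (hne y hy)] using C.mem_exactColors y hy
    · simpa using hl
    · simpa [hne y hy] using C.cycle y hy
    · simpa only [update_self] using hcol
    · simpa only [update_of_ne (hne y hy)] using C.base y hy
  have := hmax _ _ _ _ hC
  rw [card_insert_of_notMem hxY] at this
  omega

lemma own_of_mem_inner (hy : y ∈ Y) (hw : w ∈ inner A m L y) : own A f₀ w = 2 := by
  rw [mem_inner] at hw
  have h1 := h.own_of_mem (C.minColoring_update h hf₀ hy) (C.monoCycle hy)
    (List.mem_cons_of_mem _ hw.1)
  have : nbrs A (update f₀ (m y) (f₀ y)) w (f₀ w) = nbrs A f₀ w (f₀ w) := by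
    ext v
    simp only [mem_nbrs]
    refine and_congr_right fun hv => ?_
    rw [update_of_ne]
    rintro rfl
    exact hw.2 hv.symm
  rwa [own, update_of_ne (C.ne_of_mem hy hw.1), this] at h1

lemma card_bad_le (hy : y ∈ Y) : #(bad A f₀ m y) + 9 ≤ 3 * g := by
  have h2 := h.deg_le (m y)
  have hown := C.own_eq y hy
  have h3 := h.three_le_card_exactColors hf₀ hown
  have hnot : f₀ (m y) ∉ exactColors A f₀ (m y) := by simp
  set E := insert (f₀ (m y)) (exactColors A f₀ (m y)) with hE
  have h4 : #({w | Adj A (m y) w ∧ f₀ w ∈ E} : Finset V) = 2 * #E := by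
    rw [Finset.card_eq_sum_card_fiberwise (f := f₀) (t := E)]
    · rw [mul_comm, ← smul_eq_mul, ← Finset.sum_const]
      refine Finset.sum_congr rfl fun c hc => ?_
      have : #(nbrs A f₀ (m y) c) = 2 := by
        rcases mem_insert.1 hc with rfl | hc
        · exact hown
        · exact (Dicoloring.mem_exactColors.1 hc).2
      rw [← this, nbrs, Finset.filter_filter]
      congr 1
      ext v
      simp only [mem_filter, mem_univ, true_and]
      constructor
      · tauto
      · rintro ⟨h1, rfl⟩
        exact ⟨⟨h1, hc⟩, rfl⟩
    · intro v hv
      simp only [coe_filter, mem_univ, true_and, Set.mem_ofPred_eq] at hv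
      exact hv.2
  have h5 : Disjoint (bad A f₀ m y) ({w | Adj A (m y) w ∧ f₀ w ∈ E} : Finset V) := by
    rw [Finset.disjoint_left]
    intro w hw hw'
    simp only [bad, mem_filter, mem_univ, true_and] at hw hw'
    rcases mem_insert.1 hw'.2 with heq | hex
    · exact hw.2.1 heq
    · have := h.own_le_one hf₀ hown hex hw.1 rfl
      omega
  have h6 : bad A f₀ m y ∪ ({w | Adj A (m y) w ∧ f₀ w ∈ E} : Finset V) ⊆
      ({w | Adj A (m y) w} : Finset V) := by
    intro w hw
    simp only [bad, mem_union, mem_filter, mem_univ, true_and] at hw ⊢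
    exact hw.elim And.left And.left
  have h7 := Finset.card_le_card h6
  rw [card_union_of_disjoint h5, h4, card_insert_of_notMem hnot] at h7
  omega

lemma exists_cover (hg : 3 ≤ g) (hmax : ∀ Y' m' F' L', Config A S f₀ Y' m' F' L' → #Y' ≤ #Y)
    (hy : y ∈ Y) (hw : w ∈ inner A m L y) (hc : c ∈ exactColors A f₀ w) :
    ∃ y' ∈ Y, f₀ y' = c ∧ (A w y' ∨ w ∈ bad A f₀ m y') := by
  have hw2 := C.own_of_mem_inner h hf₀ hy hw
  have hwL := (mem_inner.1 hw).1
  have hun : ∀ v ∈ y :: L y, F y v = f₀ v := fun v hv =>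
    ((C.cycle y hy).2 v (List.mem_cons_of_mem _ hv)).1.trans (C.base y hy v hv).symm
  by_cases hnb : ∀ v, Adj A w v → F y v = c → f₀ v = c
  · obtain ⟨y', hy', h1, h2⟩ := C.exists_mem_of_maximal h hf₀ hg hmax (C.shift y hy)
      (h.pivot_of_mem (C.pivot y hy) (C.cycle y hy) (List.mem_cons_of_mem _ hwL)) (hun w hwL) hw2
      (fun v hv => ⟨_, C.compClosed h hf₀ hy, hwL, fun hvL => hv (hun v hvL)⟩) hc hnb
    exact ⟨y', hy', h1, Or.inl h2⟩
  · push Not at hnb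
    obtain ⟨v, hwv, hvc, hv⟩ := hnb
    obtain ⟨y', hy', rfl, hvy'⟩ := (C.shift y hy).moved v (by rw [hvc]; exact hv.symm)
    refine ⟨y', hy', hvy'.symm.trans hvc, Or.inr ?_⟩
    simp only [bad, mem_filter, mem_univ, true_and]
    refine ⟨hwv.symm, fun heq => ?_, hw2⟩
    have := hun _ (C.compClosed h hf₀ hy w hwL _ hwv heq.symm)
    exact hv (this.symm.trans hvc)

lemma eq_empty_of_maximal (hg : 3 ≤ g)
    (hmax : ∀ Y' m' F' L', Config A S f₀ Y' m' F' L' → #Y' ≤ #Y) : Y = ∅ := by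
  set I := Y.biUnion (inner A m L) with hI
  have h1 : #Y * (2 * g - 4) ≤ #I := by
    rw [hI, Finset.card_biUnion, ← smul_eq_mul, ← Finset.sum_const]
    · refine Finset.sum_le_sum fun y hy => ?_
      have := C.le_card_inner h hy
      omega
    · intro y hy y' hy' hne
      rw [Function.onFun, Finset.disjoint_left]
      intro v hv hv'
      exact hne (C.eq_of_mem h hf₀ hy hy' (mem_inner.1 hv).1 (mem_inner.1 hv').1)
  have h2 : #I * 3 ≤ #(I.sigma fun w => exactColors A f₀ w) := by
    rw [Finset.card_sigma, ← smul_eq_mul, ← Finset.sum_const]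
    refine Finset.sum_le_sum fun w hw => ?_
    obtain ⟨y, hy, hw⟩ := mem_biUnion.1 hw
    exact h.three_le_card_exactColors hf₀ (C.own_of_mem_inner h hf₀ hy hw)
  have h3 : #(I.sigma fun w => exactColors A f₀ w) ≤ #(Y.sigma fun y => ({w | A w y} : Finset V) ∪ bad A f₀ m y) := by
    refine Finset.card_le_card_of_surjOn
      (fun p : (_ : V) × V => (⟨p.2, f₀ p.1⟩ : (_ : V) × K)) ?_
    rintro ⟨w, c⟩ hwc
    rw [mem_coe, mem_sigma] at hwc
    obtain ⟨y, hy, hw⟩ := mem_biUnion.1 hwc.1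
    obtain ⟨y', hy', rfl, hyw⟩ := C.exists_cover h hf₀ hg hmax hy hw hwc.2
    exact ⟨⟨y', w⟩, by simpa [hy'] using hyw, rfl⟩
  have h4 : #(Y.sigma fun y => ({w | A w y} : Finset V) ∪ bad A f₀ m y) ≤ #Y * (6 * g - 14) := by
    rw [Finset.card_sigma, ← smul_eq_mul, ← Finset.sum_const]
    refine Finset.sum_le_sum fun y hy => (Finset.card_union_le _ _).trans ?_
    have := C.card_in_le h hy
    have := C.card_bad_le h hf₀ hy
    omega
  by_contra hne
  have hpos : 0 < #Y := Finset.card_pos.2 (Finset.nonempty_iff_ne_empty.2 hne)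
  have h5 : #Y * (2 * g - 4) * 3 ≤ #Y * (6 * g - 14) := by
    have := Nat.mul_le_mul_right 3 h1
    omega
  rw [mul_assoc] at h5
  have := Nat.le_of_mul_le_mul_left h5 hpos
  omega

end Config

lemma Obstruction.not_pivot (h : Obstruction A K g S) (u : V) : ¬ Pivot A S f₀ u := by
  intro hu
  have hown := h.pivot_own hu
  have h3 := h.three_le_card_exactColors hu.min hown
  have hg : 3 ≤ g := by
    have : exactColors A f₀ u ⊆ univ.erase (f₀ u) := fun c hc => by simpa using (mem_exactColors.1 hc).1
    have := Finset.card_le_card this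
    rw [Finset.card_erase_of_mem (mem_univ _), Finset.card_univ, h.card_eq] at this
    omega
  have hex : ∃ n, ∃ Y m F L, Config A S f₀ Y m F L ∧ Fintype.card V - #Y = n :=
    ⟨_, ∅, id, fun _ => f₀, fun _ => [], by constructor <;> simp, rfl⟩
  obtain ⟨Y, m, F, L, C, hY⟩ := Nat.find_spec hex
  have hmax : ∀ Y' m' F' L', Config A S f₀ Y' m' F' L' → #Y' ≤ #Y := by
    intro Y' m' F' L' C'
    have h1 := Nat.find_min' hex ⟨Y', m', F', L', C', rfl⟩
    have h2 := Finset.card_le_univ Y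
    have h3 := Finset.card_le_univ Y'
    omega
  obtain ⟨c, hc⟩ := Finset.card_pos.1 (by omega : 0 < #(exactColors A f₀ u))
  obtain ⟨y, hy, -⟩ := C.exists_mem_of_maximal h hu.min hg hmax (Shift.refl f₀ Y m) hu rfl hown
    (fun v hv => (hv rfl).elim) hc (fun _ _ hv => hv)
  rw [C.eq_empty_of_maximal h hu.min hg hmax] at hy
  exact Finset.notMem_empty _ hy

/-- Small degree and large girth give an acyclic colouring with `g + 1` colours. -/
lemma exists_acyclic_coloring (irr : ∀ v, ¬ A v v) (hg : 2 ≤ g) (hK : Fintype.card K = g + 1)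
    (hdeg : ∀ v, #{w | Adj A v w} + 1 ≤ 3 * g)
    (hgirth : ∀ l, IsDiCycle A l → 2 * g ≤ l.length + 1) :
    ∃ f : V → K, ∀ c, AcyclicSet A {v | f v = c} := by
  have : Nonempty K := Fintype.card_pos_iff.1 (by omega)
  have key : ∀ T : Finset V, ∃ f : V → K, MinColoring A f ∧ ∀ c l, ¬ MonoCycle A (↑T)ᶜ f c l := by
    intro T
    induction T using Finset.induction_on with
    | empty =>
      obtain ⟨f, hf⟩ := exists_minColoring (K := K) A
      refine ⟨f, hf, fun c l hl => ?_⟩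
      exact (hl.2 _ (List.head_mem hl.1.1)).2 (by simp)
    | insert u T _ ih =>
      obtain ⟨f, hf, hfT⟩ := ih
      by_contra! hcon
      have h : Obstruction A K g (↑(insert u T))ᶜ := ⟨irr, hg, hK, hdeg, hgirth, hcon⟩
      refine h.not_pivot (f₀ := f) u ⟨hf, fun c l hl => ?_⟩
      by_contra hul
      refine hfT c l ⟨hl.1, fun v hv => ⟨(hl.2 v hv).1, ?_⟩⟩
      have hvu : v ≠ u := by rintro rfl; exact hul hv
      simpa [hvu] using (hl.2 v hv).2
  obtain ⟨f, -, hf⟩ := key univ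
  refine ⟨f, fun c l hl hcyc => hf c l ⟨hcyc, fun v hv => ⟨hl v hv, by simp⟩⟩⟩

end

section

variable {V : Type*} {A : V → V → Prop} [Fintype V]

lemma undirDeg_eq (A : V → V → Prop) (v : V) : undirDeg A v = #{w | Adj A v w} := by
  rw [undirDeg, ← Set.ncard_coe_finset]
  simp only [coe_filter, mem_univ, true_and]
  rfl

lemma dichromatic_le_mul {g t : ℕ} (irr : ∀ v, ¬ A v v) (hg : 2 ≤ g) (ht : maxDeg A < 3 * g * t)
    (hgirth : digirthGE A (2 * g - 1)) : dichromatic A ≤ t * (g + 1) := by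
  have ht0 : 0 < t := Nat.pos_of_ne_zero fun h => by simp [h] at ht
  have : Nonempty (Fin t) := ⟨⟨0, ht0⟩⟩
  obtain ⟨f, hf⟩ := exists_minColoring (K := Fin t) A
  let B : V → V → Prop := fun u v => A u v ∧ f u = f v
  have hBA : ∀ l, IsDiCycle B l → IsDiCycle A l := fun l hl =>
    ⟨hl.1, hl.2.1, hl.2.2.1.imp fun _ _ h => h.1, fun h => (hl.2.2.2 h).1⟩
  obtain ⟨e, he⟩ := exists_acyclic_coloring (A := B) (K := Fin (g + 1)) (g := g)
    (fun v hv => irr v hv.1) hg (by simp) (fun v => by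
      have h1 := hf.card_mul_own_le irr v
      have h2 : undirDeg A v ≤ maxDeg A := Finset.le_sup (f := undirDeg A) (mem_univ v)
      have h3 : #{w | Adj B v w} ≤ #(nbrs A f v (f v)) := by
        refine Finset.card_le_card fun w hw => ?_
        simp only [mem_filter, mem_univ, true_and] at hw
        rw [mem_nbrs]
        rcases hw with hw | hw
        exacts [⟨Or.inl hw.1, hw.2.symm⟩, ⟨Or.inr hw.1, hw.2⟩]
      rw [undirDeg_eq] at h2
      rw [Fintype.card_fin] at h1
      have h4 : t * #(nbrs A f v (f v)) < t * (3 * g) := by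
        rw [mul_comm t (3 * g)]
        omega
      have := Nat.lt_of_mul_lt_mul_left h4
      omega)
    (fun l hl => by have := hgirth l (hBA l hl); omega)
  refine Nat.sInf_le ⟨fun v => finProdFinEquiv (f v, e v), fun i l hl hcyc => ?_⟩
  have hfe : ∀ v ∈ l, (f v, e v) = finProdFinEquiv.symm i := fun v hv => by
    rw [← hl v hv, Equiv.symm_apply_apply]
  have hfl : ∀ v ∈ l, f v = (finProdFinEquiv.symm i).1 := fun v hv => congrArg Prod.fst (hfe v hv)
  refine he (finProdFinEquiv.symm i).2 l (fun v hv => congrArg Prod.snd (hfe v hv))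
    ⟨hcyc.1, hcyc.2.1, ?_, fun h => ⟨hcyc.2.2.2 h, ?_⟩⟩
  · have hch : l.IsChain A := hcyc.2.2.1
    exact List.IsChain.imp_of_mem_imp
      (fun u v hu hv huv => ⟨huv, (hfl u hu).trans (hfl v hv).symm⟩) hch
  · rw [hfl _ (List.getLast_mem h), hfl _ (List.head_mem h)]

end

end Dicoloring

/-- **Theorem 1 (main).** For every natural number `g ≥ 2`, every digraph `D`
(finite, loopless) of digirth at least `2g - 1` and maximum degree `Δ` satisfies
`χ⃗(D) ≤ (1/3 + 1/(3g)) Δ + (g + 1)`. -/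
theorem dichromatic_le_of_digirth_ge {V : Type*} [Fintype V] (A : V → V → Prop)
    (hirr : Irreflexive A) (g : ℕ) (hg : 2 ≤ g)
    (hgirth : digirthGE A (2 * g - 1)) :
    (dichromatic A : ℝ) ≤ (1 / 3 + 1 / (3 * g)) * (maxDeg A : ℝ) + (g + 1) := by
  have hg0 : 0 < 3 * g := by omega
  have h1 : dichromatic A ≤ (maxDeg A / (3 * g) + 1) * (g + 1) :=
    Dicoloring.dichromatic_le_mul hirr hg (Nat.lt_mul_div_succ _ hg0) hgirth
  have h2 : ((maxDeg A / (3 * g) : ℕ) : ℝ) ≤ maxDeg A / (3 * g) := by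
    exact_mod_cast Nat.cast_div_le (α := ℝ) (m := maxDeg A) (n := 3 * g)
  have hgR : (0 : ℝ) < g := by positivity
  calc (dichromatic A : ℝ) ≤ (((maxDeg A / (3 * g) : ℕ) : ℝ) + 1) * (g + 1) := by exact_mod_cast h1
    _ ≤ ((maxDeg A : ℝ) / (3 * g) + 1) * (g + 1) := by gcongr
    _ = (1 / 3 + 1 / (3 * g)) * (maxDeg A : ℝ) + (g + 1) := by
      field_simp
end

section
/- Let D be a digraph (finite, without loops or parallel arcs) whose digirth is strictly greater than its maximum out-degree Δ⁺(D). Then the dichromatic number of D satisfies χ⃗(D) ≤ ⌊Δ(D)/3⌋ + 2. -/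
/-- A directed cycle that meets a set closed under the arcs inside the cycle lies in that set. -/
theorem IsDiCycle.subset_of_closed {V : Type*} {A : V → V → Prop} {l : List V}
    (hl : IsDiCycle A l) {X : Set V}
    (hX : ∀ a ∈ X, ∀ b ∈ l, A a b → b ∈ X) {x : V} (hxl : x ∈ l) (hx : x ∈ X) :
    ∀ y ∈ l, y ∈ X := by
  obtain ⟨hne, -, hch, hlast⟩ := hl
  have key : ∀ m : List V, (∀ y ∈ m, y ∈ l) → m.IsChain A → ∀ h : m ≠ [], m.head h ∈ X →
      ∀ y ∈ m, y ∈ X := by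
    intro m
    induction m with
    | nil => simp
    | cons a m ih =>
      intro hm hc _ ha y hy
      rcases List.mem_cons.1 hy with rfl | hy
      · exact ha
      cases m with
      | nil => simp at hy
      | cons b m =>
        rw [List.isChain_cons_cons] at hc
        exact ih (fun y hy => hm y (List.mem_cons_of_mem _ hy)) hc.2 (by simp)
          (hX a ha b (hm b (by simp)) hc.1) y hy
  obtain ⟨l₁, l₂, rfl⟩ := List.append_of_mem hxl
  have hlastX : (l₁ ++ x :: l₂).getLast hne ∈ X := by
    have h₂ : (x :: l₂) ≠ [] := by simp
    rw [List.getLast_append_of_ne_nil _ h₂]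
    exact key (x :: l₂) (fun y hy => List.mem_append_right _ hy) hch.right_of_append h₂ hx _
      (List.getLast_mem h₂)
  exact key _ (fun _ h => h) hch hne (hX _ hlastX _ (List.head_mem hne) (hlast hne))

theorem AcyclicSet.mono {V : Type*} {A : V → V → Prop} {X Y : Set V}
    (hY : AcyclicSet A Y) (h : X ⊆ Y) : AcyclicSet A X :=
  fun l hl => hY l fun v hv => h (hl v hv)

/-- The union of two acyclic sets with no arc from the first to the second is acyclic. -/
theorem AcyclicSet.union {V : Type*} {A : V → V → Prop} {X Y : Set V}
    (hX : AcyclicSet A X) (hY : AcyclicSet A Y) (h : ∀ x ∈ X, ∀ y ∈ Y, ¬ A x y) :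
    AcyclicSet A (X ∪ Y) := by
  intro l hl hc
  by_cases hm : ∃ x ∈ l, x ∈ X
  · obtain ⟨x, hxl, hx⟩ := hm
    refine hX l (hc.subset_of_closed (fun a ha b hb hab => ?_) hxl hx) hc
    exact (hl b hb).resolve_right fun hbY => h a ha b hbY hab
  · push Not at hm
    exact hY l (fun v hv => (hl v hv).resolve_left (hm v hv)) hc

theorem IsDiCycle.exists_pred {V : Type*} {A : V → V → Prop} {l : List V}
    (hl : IsDiCycle A l) {x : V} (hx : x ∈ l) : ∃ y ∈ l, A y x := by
  obtain ⟨hne, -, hch, hlast⟩ := hl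
  obtain ⟨l₁, l₂, rfl⟩ := List.append_of_mem hx
  rcases List.eq_nil_or_concat l₁ with rfl | ⟨m, y, rfl⟩
  · exact ⟨_, List.getLast_mem hne, hlast hne⟩
  · refine ⟨y, by simp, ?_⟩
    have := List.isChain_append.1 hch
    exact this.2.2 y (by simp) x (by simp)

theorem IsDiCycle.exists_succ {V : Type*} {A : V → V → Prop} {l : List V}
    (hl : IsDiCycle A l) {x : V} (hx : x ∈ l) : ∃ y ∈ l, A x y := by
  obtain ⟨hne, -, hch, hlast⟩ := hl
  obtain ⟨l₁, l₂, rfl⟩ := List.append_of_mem hx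
  cases l₂ with
  | nil =>
    refine ⟨_, List.head_mem hne, ?_⟩
    simpa using hlast hne
  | cons y l₂ =>
    refine ⟨y, by simp, ?_⟩
    exact (List.isChain_cons_cons.1 hch.right_of_append).1

theorem outDeg_le_maxOutDeg {V : Type*} [Fintype V] (A : V → V → Prop) (v : V) :
    outDeg A v ≤ maxOutDeg A :=
  Finset.le_sup (f := outDeg A) (Finset.mem_univ v)

theorem undirDeg_le_maxDeg {V : Type*} [Fintype V] (A : V → V → Prop) (v : V) :
    undirDeg A v ≤ maxDeg A :=
  Finset.le_sup (f := undirDeg A) (Finset.mem_univ v)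

section Transversal

variable {V ι : Type*} [Fintype V]

/-- `t` picks from each class `C i`, `i ∈ J`, a vertex that receives no arc from `Z`,
and the chosen vertices form an acyclic set. -/
def IsAvoidingTransversal (A : V → V → Prop) (C : ι → Finset V) (J : Finset ι) (Z : Finset V)
    (t : ι → V) : Prop :=
  (∀ i ∈ J, t i ∈ C i ∧ ∀ z ∈ Z, ¬ A z (t i)) ∧ AcyclicSet A (t '' J)

open Classical in
/-- If few vertices `Z` are used compared to the number of classes in `S`, some vertex in the
classes of `S` receives no arc from `Z`. -/
theorem exists_not_dominated {A : V → V → Prop} {C : ι → Finset V}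
    (hdisj : Pairwise fun i j => Disjoint (C i) (C j))
    (hcard : ∀ i, maxOutDeg A < (C i).card) {S : Finset ι} {Z : Finset V}
    (hZ : maxOutDeg A * Z.card + (maxOutDeg A + 1) ≤ (maxOutDeg A + 1) * S.card) :
    ∃ i ∈ S, ∃ v ∈ C i, ∀ z ∈ Z, ¬ A z v := by
  by_contra! h
  have h₁ : S.biUnion C ⊆ Z.biUnion fun z => Finset.univ.filter (A z) := by
    intro v hv
    obtain ⟨i, hi, hv⟩ := Finset.mem_biUnion.1 hv
    obtain ⟨z, hz, hzv⟩ := h i hi v hv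
    exact Finset.mem_biUnion.2 ⟨z, hz, by simpa using hzv⟩
  have h₂ : (Z.biUnion fun z => Finset.univ.filter (A z)).card ≤ Z.card * maxOutDeg A := by
    refine Finset.card_biUnion_le_card_mul _ _ _ fun z _ => ?_
    refine le_trans (le_of_eq ?_) (outDeg_le_maxOutDeg A z)
    rw [outDeg, ← Set.ncard_coe_finset]
    simp
  have h₃ : S.card * (maxOutDeg A + 1) ≤ (S.biUnion C).card := by
    rw [Finset.card_biUnion fun i _ j _ hij => hdisj hij]
    simpa using Finset.card_nsmul_le_sum S (fun i => (C i).card) (maxOutDeg A + 1) fun i _ => hcard i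
  have := Finset.card_le_card h₁
  nlinarith

open Classical in
/-- Exchange step: an avoiding transversal of `J` can be chosen so that some undominated vertex in
the classes of `S` can be added to it. -/
theorem exists_extendable_transversal {A : V → V → Prop} {C : ι → Finset V}
    (hirr : ∀ v, ¬ A v v)
    (hgirth : ∀ l : List V, IsDiCycle A l → maxOutDeg A < l.length)
    (hdisj : Pairwise fun i j => Disjoint (C i) (C j))
    (hcard : ∀ i, maxOutDeg A < (C i).card) (J : Finset ι) :
    ∀ (S : Finset ι) (Z : Finset V), Disjoint S J →
    maxOutDeg A * Z.card + (maxOutDeg A + 1) ≤ (maxOutDeg A + 1) * S.card →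
    (∃ t, IsAvoidingTransversal A C J Z t) →
    ∃ t, IsAvoidingTransversal A C J Z t ∧ ∃ i ∈ S, ∃ v ∈ C i, (∀ z ∈ Z, ¬ A z v) ∧
      AcyclicSet A (insert v (t '' J)) := by
  induction J using Finset.strongInduction with
  | H J ih =>
  intro S Z hSJ hZ hex
  obtain ⟨i₀, hi₀, v, hv, hvZ⟩ := exists_not_dominated hdisj hcard hZ
  -- Take a transversal and a subset of it closed under arcs from `v` of minimum size.
  let P : ℕ → Prop := fun n => ∃ t, ∃ R ⊆ J, IsAvoidingTransversal A C J Z t ∧ R.card = n ∧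
    ∀ a ∈ insert v (t '' R), ∀ i ∈ J, A a (t i) → i ∈ R
  have hP : ∃ n, P n := by
    obtain ⟨t, ht⟩ := hex
    exact ⟨_, t, J, subset_rfl, ht, rfl, fun _ _ i hi _ => hi⟩
  obtain ⟨t, R, hRJ, ht, hRn, hR⟩ := Nat.find_spec hP
  by_cases hac : AcyclicSet A (insert v (t '' J))
  · exact ⟨t, ht, i₀, hi₀, v, hv, hvZ, hac⟩
  have hdR : maxOutDeg A ≤ R.card := by
    unfold AcyclicSet at hac
    push Not at hac
    obtain ⟨l, hl, hc⟩ := hac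
    have hvl : v ∈ l := by
      by_contra hvl
      refine ht.2 l (fun x hx => ?_) hc
      exact (hl x hx).resolve_left fun h => hvl (h ▸ hx)
    have hsub := hc.subset_of_closed (X := insert v (t '' R)) (fun a ha b hb hab => by
      rcases hl b hb with rfl | ⟨i, hi, rfl⟩
      · exact Or.inl rfl
      · exact Or.inr ⟨i, hR a ha i hi hab, rfl⟩) hvl (Or.inl rfl)
    have h₁ : l.toFinset ⊆ insert v (R.image t) := by
      intro x hx
      have := hsub x (List.mem_toFinset.1 hx)
      rcases this with rfl | ⟨i, hi, rfl⟩
      · simp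
      · exact Finset.mem_insert_of_mem (Finset.mem_image_of_mem _ hi)
    have h₂ := Finset.card_le_card h₁
    rw [List.toFinset_card_of_nodup hc.2.1] at h₂
    have h₃ := Finset.card_insert_le v (R.image t)
    have h₄ := Finset.card_image_le (s := R) (f := t)
    have h₅ := hgirth l hc
    omega
  have hRne : R.Nonempty := by
    by_contra hRe
    rw [Finset.not_nonempty_iff_eq_empty] at hRe
    subst hRe
    refine hac (Set.insert_eq v _ ▸ AcyclicSet.union ?_ ht.2 ?_)
    · intro l hl hc
      obtain ⟨x, hx⟩ := List.exists_mem_of_ne_nil l hc.1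
      obtain ⟨y, hy, hxy⟩ := hc.exists_succ hx
      have h₁ := hl x hx
      have h₂ := hl y hy
      simp only [Set.mem_singleton_iff] at h₁ h₂
      subst h₁ h₂
      exact hirr _ hxy
    · rintro x hx y ⟨i, hi, rfl⟩ hxy
      have := hR x (Or.inl hx) i hi hxy
      simp at this
  have hJ' : J \ R ⊂ J := Finset.sdiff_ssubset hRJ hRne
  have hSR : Disjoint S R := hSJ.mono_right hRJ
  have hdisj' : Disjoint (S ∪ R) (J \ R) :=
    Finset.disjoint_union_left.2 ⟨hSJ.mono_right Finset.sdiff_subset, Finset.disjoint_sdiff⟩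
  have hZ' : maxOutDeg A * (insert v (Z ∪ R.image t)).card + (maxOutDeg A + 1) ≤
      (maxOutDeg A + 1) * (S ∪ R).card := by
    rw [Finset.card_union_of_disjoint hSR]
    have h₁ := Finset.card_insert_le v (Z ∪ R.image t)
    have h₂ := Finset.card_union_le Z (R.image t)
    have h₃ := Finset.card_image_le (s := R) (f := t)
    have h₄ : (insert v (Z ∪ R.image t)).card ≤ Z.card + R.card + 1 := by omega
    have h₅ := Nat.mul_le_mul_left (maxOutDeg A) h₄
    nlinarith
  have hex' : ∃ s, IsAvoidingTransversal A C (J \ R) (insert v (Z ∪ R.image t)) s := by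
    refine ⟨t, fun i hi => ⟨(ht.1 i (hJ'.1 hi)).1, fun z hz hzi => ?_⟩,
      ht.2.mono (Set.image_mono (Finset.coe_subset.2 hJ'.1))⟩
    rw [Finset.mem_sdiff] at hi
    simp only [Finset.mem_insert, Finset.mem_union, Finset.mem_image] at hz
    rcases hz with rfl | hz | ⟨j, hj, rfl⟩
    · exact hi.2 (hR _ (Or.inl rfl) i hi.1 hzi)
    · exact (ht.1 i hi.1).2 z hz hzi
    · exact hi.2 (hR _ (Or.inr ⟨j, hj, rfl⟩) i hi.1 hzi)
  obtain ⟨t', ht', i, hi, w, hw, hwZ, hwac⟩ := ih _ hJ' _ _ hdisj' hZ' hex'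
  have hwv : ¬ A v w := hwZ v (by simp)
  have hwZ₀ : ∀ z ∈ Z, ¬ A z w := fun z hz => hwZ z (by simp [hz])
  have hwR : ∀ j ∈ R, ¬ A (t j) w := fun j hj => hwZ _ (by
    simp only [Finset.mem_insert, Finset.mem_union, Finset.mem_image]
    exact Or.inr (Or.inr ⟨j, hj, rfl⟩))
  have htv : ∀ j ∈ J, j ∉ R → ¬ A v (t' j) := fun j hj hjR =>
    (ht'.1 j (Finset.mem_sdiff.2 ⟨hj, hjR⟩)).2 v (by simp)
  have htZ : ∀ j ∈ J, j ∉ R → ∀ z ∈ Z, ¬ A z (t' j) := fun j hj hjR z hz =>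
    (ht'.1 j (Finset.mem_sdiff.2 ⟨hj, hjR⟩)).2 z (by simp [hz])
  have htR : ∀ j ∈ J, j ∉ R → ∀ k ∈ R, ¬ A (t k) (t' j) := fun j hj hjR k hk =>
    (ht'.1 j (Finset.mem_sdiff.2 ⟨hj, hjR⟩)).2 _ (by
      simp only [Finset.mem_insert, Finset.mem_union, Finset.mem_image]
      exact Or.inr (Or.inr ⟨k, hk, rfl⟩))
  have hun : AcyclicSet A (t '' R ∪ insert w (t' '' (J \ R : Finset ι))) := by
    refine (ht.2.mono (Set.image_mono (Finset.coe_subset.2 hRJ))).union hwac ?_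
    rintro _ ⟨k, hk, rfl⟩ y (rfl | ⟨j, hj, rfl⟩)
    · exact hwR k hk
    · have := Finset.mem_sdiff.1 hj
      exact htR j this.1 this.2 k hk
  rcases Finset.mem_union.1 hi with hiS | hiR
  · have himg : ∀ j ∈ J, (if j ∈ R then t j else t' j) ∈
        t '' R ∪ insert w (t' '' (J \ R : Finset ι)) := by
      intro j hj
      split_ifs with hjR
      · exact Or.inl ⟨j, hjR, rfl⟩
      · exact Or.inr (Or.inr ⟨j, Finset.mem_sdiff.2 ⟨hj, hjR⟩, rfl⟩)
    refine ⟨fun j => if j ∈ R then t j else t' j, ⟨fun j hj => ?_, hun.mono ?_⟩,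
      i, hiS, w, hw, hwZ₀, hun.mono ?_⟩
    · dsimp only
      split_ifs with hjR
      · exact ht.1 j hj
      · exact ⟨(ht'.1 j (Finset.mem_sdiff.2 ⟨hj, hjR⟩)).1, htZ j hj hjR⟩
    · rintro _ ⟨j, hj, rfl⟩
      exact himg j hj
    · rintro _ (rfl | ⟨j, hj, rfl⟩)
      · exact Or.inr (Or.inl rfl)
      · exact himg j hj
  · -- Replacing the vertex of class `i` by `w` shrinks the closed subset.
    exfalso
    refine Nat.find_min hP (m := (R.erase i).card)
      (hRn ▸ Finset.card_erase_lt_of_mem hiR) ?_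
    refine ⟨fun j => if j = i then w else if j ∈ R then t j else t' j, R.erase i,
      (Finset.erase_subset _ _).trans hRJ, ⟨fun j hj => ?_, hun.mono ?_⟩, rfl, ?_⟩
    · dsimp only
      split_ifs with hji hjR
      · exact ⟨hji ▸ hw, hwZ₀⟩
      · exact ht.1 j hj
      · exact ⟨(ht'.1 j (Finset.mem_sdiff.2 ⟨hj, hjR⟩)).1, htZ j hj hjR⟩
    · rintro _ ⟨j, hj, rfl⟩
      dsimp only
      split_ifs with hji hjR
      · exact Or.inr (Or.inl rfl)
      · exact Or.inl ⟨j, hjR, rfl⟩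
      · exact Or.inr (Or.inr ⟨j, Finset.mem_sdiff.2 ⟨hj, hjR⟩, rfl⟩)
    · intro a ha j hj haj
      have ha' : a = v ∨ ∃ k ∈ R, a = t k := by
        rcases ha with rfl | ⟨k, hk, rfl⟩
        · exact Or.inl rfl
        · have := Finset.mem_erase.1 hk
          exact Or.inr ⟨k, this.2, by simp [this.1, this.2]⟩
      by_contra hjR
      dsimp only at haj
      split_ifs at haj with hji hjR'
      · rcases ha' with rfl | ⟨k, hk, rfl⟩
        exacts [hwv haj, hwR k hk haj]
      · exact hjR (Finset.mem_erase.2 ⟨hji, hjR'⟩)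
      · rcases ha' with rfl | ⟨k, hk, rfl⟩
        exacts [htv j hj hjR' haj, htR j hj hjR' k hk haj]

open Classical in
/-- In a digraph whose digirth exceeds its maximum out-degree `d`, any pairwise disjoint classes
with more than `d` vertices each have an acyclic transversal. -/
theorem exists_acyclic_transversal {A : V → V → Prop} {C : ι → Finset V}
    (hirr : ∀ v, ¬ A v v)
    (hgirth : ∀ l : List V, IsDiCycle A l → maxOutDeg A < l.length)
    (hdisj : Pairwise fun i j => Disjoint (C i) (C j))
    (hcard : ∀ i, maxOutDeg A < (C i).card) (J : Finset ι) :
    ∃ t : ι → V, (∀ i ∈ J, t i ∈ C i) ∧ AcyclicSet A (t '' J) := by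
  induction J using Finset.induction_on with
  | empty =>
    choose t ht using fun i => Finset.card_pos.1 ((Nat.zero_le _).trans_lt (hcard i))
    refine ⟨t, fun i _ => ht i, fun l hl hc => ?_⟩
    obtain ⟨x, hx⟩ := List.exists_mem_of_ne_nil l hc.1
    simpa using hl x hx
  | insert i J hi ih =>
    obtain ⟨t, ht, hac⟩ := ih
    obtain ⟨t', ht', k, hk, v, hv, -, hvac⟩ :=
      exists_extendable_transversal hirr hgirth hdisj hcard J {i} ∅
        (Finset.disjoint_singleton_left.2 hi) (by simp) ⟨t, fun j hj => ⟨ht j hj, by simp⟩, hac⟩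
    rw [Finset.mem_singleton] at hk
    subst hk
    have hne : ∀ j ∈ J, j ≠ k := fun j hj h => hi (h ▸ hj)
    refine ⟨Function.update t' k v, fun j hj => ?_, hvac.mono ?_⟩
    · rcases Finset.mem_insert.1 hj with rfl | hj
      · simpa using hv
      · rw [Function.update_of_ne (hne j hj)]
        exact (ht'.1 j hj).1
    · rintro _ ⟨j, hj, rfl⟩
      rcases Finset.mem_insert.1 hj with rfl | hj
      · simp
      · rw [Function.update_of_ne (hne j hj)]
        exact Or.inr ⟨j, hj, rfl⟩

end Transversal

section Partition

variable {V : Type*} [Fintype V]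

theorem sum_sum_eq_two_mul_add [DecidableEq V] (h : V → V → ℕ) (hsymm : ∀ u w, h u w = h w u)
    (v : V) (hv : h v v = 0) :
    ∑ u, ∑ w, h u w = 2 * ∑ w, h v w +
      ∑ u ∈ Finset.univ.erase v, ∑ w ∈ Finset.univ.erase v, h u w := by
  have h₁ : ∀ g : V → ℕ, ∑ u, g u = g v + ∑ u ∈ Finset.univ.erase v, g u := fun g =>
    (Finset.add_sum_erase _ g (Finset.mem_univ v)).symm
  have h₂ : ∑ u ∈ Finset.univ.erase v, h u v = ∑ w, h v w := by
    rw [h₁ (h v), hv, zero_add]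
    exact Finset.sum_congr rfl fun u _ => hsymm u v
  rw [h₁, Finset.sum_congr rfl fun u _ => h₁ (h u), Finset.sum_add_distrib, h₂]
  ring

open Classical in
/-- A symmetric irreflexive relation of maximum degree less than `3 * k` has a coloring with `k`
colors in which every vertex has at most two neighbors of its own color. -/
theorem exists_coloring_card_le_two {r : V → V → Prop} (hsymm : ∀ u w, r u w → r w u)
    (hirr : ∀ v, ¬ r v v) {k : ℕ} (hk : 0 < k)
    (hdeg : ∀ v, (Finset.univ.filter (r v)).card < 3 * k) :
    ∃ f : V → Fin k, ∀ v, (Finset.univ.filter fun u => r v u ∧ f u = f v).card ≤ 2 := by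
  have : Nonempty (Fin k) := ⟨⟨0, hk⟩⟩
  let h : (V → Fin k) → V → V → ℕ := fun f u w => if r u w ∧ f w = f u then 1 else 0
  obtain ⟨f, hf⟩ := Finite.exists_min fun f : V → Fin k => ∑ u, ∑ w, h f u w
  refine ⟨f, fun v => ?_⟩
  by_contra! hv
  have hb : ∀ b : Fin k, 3 ≤ (Finset.univ.filter fun u => r v u ∧ f u = b).card := by
    intro b
    refine le_trans hv ?_
    have hsy : ∀ g u w, h g u w = h g w u := by
      intro g u w
      have : (r u w ∧ g w = g u) ↔ (r w u ∧ g u = g w) :=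
        ⟨fun h => ⟨hsymm _ _ h.1, h.2.symm⟩, fun h => ⟨hsymm _ _ h.1, h.2.symm⟩⟩
      simp only [h, this]
    have hv₀ : ∀ g, h g v v = 0 := fun g => by simp [h, hirr v]
    have key := hf (Function.update f v b)
    rw [sum_sum_eq_two_mul_add _ (hsy _) v (hv₀ _), sum_sum_eq_two_mul_add _ (hsy _) v (hv₀ _)]
      at key
    have h₁ : ∑ u ∈ Finset.univ.erase v, ∑ w ∈ Finset.univ.erase v, h (Function.update f v b) u w =
        ∑ u ∈ Finset.univ.erase v, ∑ w ∈ Finset.univ.erase v, h f u w := by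
      refine Finset.sum_congr rfl fun u hu => Finset.sum_congr rfl fun w hw => ?_
      simp only [h, Function.update_of_ne (Finset.ne_of_mem_erase hu),
        Function.update_of_ne (Finset.ne_of_mem_erase hw)]
    have h₂ : ∑ w, h f v w = (Finset.univ.filter fun u => r v u ∧ f u = f v).card := by
      simp [h]
    have h₃ : ∑ w, h (Function.update f v b) v w =
        (Finset.univ.filter fun u => r v u ∧ f u = b).card := by
      rw [Finset.card_filter]
      refine Finset.sum_congr rfl fun w _ => ?_
      by_cases hw : w = v
      · subst hw
        simp [h, hirr w]
      · simp [h, Function.update_of_ne hw]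
    omega
  have hsum : ∑ b : Fin k, (Finset.univ.filter fun u => r v u ∧ f u = b).card =
      (Finset.univ.filter (r v)).card := by
    rw [Finset.card_eq_sum_card_fiberwise (f := f) (t := Finset.univ) fun _ _ => by simp]
    exact Finset.sum_congr rfl fun b _ => by rw [Finset.filter_filter]
  have := Finset.card_nsmul_le_sum Finset.univ _ _ fun b _ => hb b
  rw [hsum] at this
  have := hdeg v
  simp at *
  omega

open Classical in
/-- If every vertex has at most two neighbors of its own color, then a monochromatic directed cycle
is closed under monochromatic arcs. -/
theorem IsDiCycle.mem_of_monochromatic_arc {A : V → V → Prop} {α : Type*} {f : V → α}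
    (hirr : ∀ v, ¬ A v v)
    (hgirth : ∀ l : List V, IsDiCycle A l → maxOutDeg A < l.length)
    (hf : ∀ v, (Finset.univ.filter fun u => (A v u ∨ A u v) ∧ f u = f v).card ≤ 2)
    {l : List V} (hl : IsDiCycle A l) {c : α} (hc : ∀ v ∈ l, f v = c) {x y : V} (hx : x ∈ l)
    (hy : f y = c) (hxy : A x y) : y ∈ l := by
  obtain ⟨s, hs, hxs⟩ := hl.exists_succ hx
  obtain ⟨p, hp, hpx⟩ := hl.exists_pred hx
  by_contra hyl
  have hys : y ≠ s := fun h => hyl (h ▸ hs)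
  have hyp : y ≠ p := fun h => hyl (h ▸ hp)
  have hd : 2 ≤ maxOutDeg A := by
    refine le_trans ?_ (outDeg_le_maxOutDeg A x)
    rw [outDeg, ← Set.ncard_pair hys]
    exact Set.ncard_le_ncard (by rintro u (rfl | rfl) <;> assumption) (Set.toFinite _)
  have hsp : s ≠ p := by
    rintro rfl
    have hne : x ≠ s := fun h => hirr x (h ▸ hxs)
    have := hgirth [x, s] ⟨by simp, by simpa using hne,
      List.isChain_pair.2 hxs, fun _ => by simpa using hpx⟩
    simp at this
    omega
  have h₁ : ({y, s, p} : Finset V) ⊆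
      Finset.univ.filter fun u => (A x u ∨ A u x) ∧ f u = f x := by
    intro u hu
    simp only [Finset.mem_insert, Finset.mem_singleton] at hu
    rcases hu with rfl | rfl | rfl <;> simp [*]
  have h₂ := Finset.card_le_card h₁
  rw [Finset.card_eq_three.2 ⟨y, s, p, hys, hyp, hsp, rfl⟩] at h₂
  have := hf x
  omega

end Partition

/-- **Lemma 4.** If `D` is a digraph with digirth strictly greater than its maximum
out-degree `Δ⁺(D)`, then `χ⃗(D) ≤ ⌊Δ(D)/3⌋ + 2`. -/
theorem dichromatic_le_of_digirth_gt_maxOutDeg {V : Type*} [Fintype V]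
    (A : V → V → Prop) (hirr : Irreflexive A)
    (hgirth : ∀ l : List V, IsDiCycle A l → maxOutDeg A < l.length) :
    dichromatic A ≤ maxDeg A / 3 + 2 := by
  classical
  have hirr' : ∀ v, ¬ A v v := fun v => hirr v
  obtain ⟨f, hf⟩ := exists_coloring_card_le_two (r := fun u w => A u w ∨ A w u)
    (fun _ _ => Or.symm) (by simpa using hirr') (k := maxDeg A / 3 + 1) (by omega) (fun v => by
      have h₁ : (Finset.univ.filter fun w => A v w ∨ A w v).card = undirDeg A v := by
        rw [undirDeg, ← Set.ncard_coe_finset]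
        simp
      have h₂ := undirDeg_le_maxDeg A v
      have h₃ := h₁.le.trans h₂
      have h₄ : maxDeg A < 3 * (maxDeg A / 3 + 1) := by omega
      refine lt_of_le_of_lt (le_of_eq ?_) (h₃.trans_lt h₄)
      congr!)
  -- The classes are the vertex sets of monochromatic directed cycles.
  let ι := {X : Finset V // ∃ l : List V, IsDiCycle A l ∧ (∃ c, ∀ v ∈ l, f v = c) ∧ l.toFinset = X}
  have hsub : ∀ X Y : ι, ∀ x ∈ X.1, x ∈ Y.1 → Y.1 ⊆ X.1 := by
    rintro ⟨X, l, hl, ⟨c, hc⟩, rfl⟩ ⟨Y, m, hm, ⟨c', hc'⟩, rfl⟩ x hx hx'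
    simp only [List.mem_toFinset] at hx hx'
    have hcc : c' = c := (hc' x hx').symm.trans (hc x hx)
    intro y hy
    rw [List.mem_toFinset] at hy ⊢
    exact hm.subset_of_closed (X := {v | v ∈ l}) (fun a ha b hb hab =>
      hl.mem_of_monochromatic_arc hirr' hgirth (fun v => by convert hf v) hc ha (hcc ▸ hc' b hb) hab) hx' hx y hy
  obtain ⟨t, ht, hac⟩ := exists_acyclic_transversal (C := fun X : ι => X.1) hirr' hgirth
    (fun X Y hXY => Finset.disjoint_left.2 fun x hx hx' => hXY
      (Subtype.ext ((hsub Y X x hx' hx).antisymm (hsub X Y x hx hx'))))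
    (by
      rintro ⟨X, l, hl, -, rfl⟩
      dsimp only
      rw [List.toFinset_card_of_nodup hl.2.1]
      exact hgirth l hl) Finset.univ
  refine Nat.sInf_le ⟨fun v => if v ∈ Set.range t then Fin.last _ else (f v).castSucc, fun i => ?_⟩
  intro l hl hc
  simp only [Set.mem_ofPred_eq] at hl
  by_cases hi : i = Fin.last _
  · refine hac l (fun v hv => ?_) hc
    have := hl v hv
    split_ifs at this with h
    · simpa using h
    · exact absurd (this.trans hi) (Fin.castSucc_lt_last _).ne
  · have hl' : ∀ v ∈ l, v ∉ Set.range t ∧ (f v).castSucc = i := by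
      intro v hv
      have := hl v hv
      split_ifs at this with h
      · exact absurd this.symm hi
      · exact ⟨h, this⟩
    obtain ⟨x, hx⟩ := List.exists_mem_of_ne_nil l hc.1
    let X : ι := ⟨l.toFinset, l, hc, ⟨f x, fun v hv =>
      Fin.castSucc_injective _ ((hl' v hv).2.trans (hl' x hx).2.symm)⟩, rfl⟩
    exact (hl' (t X) (List.mem_toFinset.1 (ht X (Finset.mem_univ _)))).1 ⟨X, rfl⟩
end

section
/- Let G be a finite undirected graph and let k be a positive natural number. Then the vertex set of G admits a partition X₁,…,X_k such that for every i ∈ {1,…,k} and every vertex v ∈ X_i, the degree of v in the induced subgraph G[X_i] is at most (1/k)·deg_G(v). -/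
/-- Isolating the row and column of `v` in a double sum of a symmetric function vanishing at
`(v, v)`. -/
theorem sum_sum_eq_sum_erase_add_two_mul {V : Type*} [Fintype V] [DecidableEq V]
    (w : V → V → ℕ) (hw : ∀ x y, w x y = w y x) (v : V) (hv : w v v = 0) :
    ∑ x, ∑ y, w x y =
      ∑ x ∈ Finset.univ.erase v, ∑ y ∈ Finset.univ.erase v, w x y + 2 * ∑ y, w v y := by
  have split (g : V → ℕ) : ∑ x, g x = g v + ∑ x ∈ Finset.univ.erase v, g x :=
    (Finset.add_sum_erase _ g (Finset.mem_univ v)).symm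
  have column : ∑ x ∈ Finset.univ.erase v, w x v = ∑ y, w v y := by
    rw [split (w v), hv, zero_add]
    exact Finset.sum_congr rfl fun x _ => hw x v
  have rows : ∑ x ∈ Finset.univ.erase v, ∑ y, w x y =
      ∑ x ∈ Finset.univ.erase v, w x v +
        ∑ x ∈ Finset.univ.erase v, ∑ y ∈ Finset.univ.erase v, w x y := by
    rw [← Finset.sum_add_distrib]
    exact Finset.sum_congr rfl fun x _ => split (w x)
  rw [split fun x => ∑ y, w x y, rows, column]
  ring

open Classical in
/-- Some `k`-coloring is locally optimal: no vertex has fewer neighbors in another color class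
than in its own. -/
theorem SimpleGraph.exists_forall_card_adj_le {V : Type*} [Fintype V] (G : SimpleGraph V)
    {k : ℕ} (hk : 0 < k) :
    ∃ f : V → Fin k, ∀ (v : V) (j : Fin k),
      (Finset.univ.filter fun u => G.Adj v u ∧ f u = f v).card ≤
        (Finset.univ.filter fun u => G.Adj v u ∧ f u = j).card := by
  have : Nonempty (Fin k) := ⟨⟨0, hk⟩⟩
  let w (f : V → Fin k) (x y : V) : ℕ := if G.Adj x y ∧ f y = f x then 1 else 0
  have w_symm (f : V → Fin k) (x y : V) : w f x y = w f y x := by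
    simp only [w, G.adj_comm x y, eq_comm (a := f x)]
  obtain ⟨f, hf⟩ := Finite.exists_min fun f : V → Fin k => ∑ x, ∑ y, w f x y
  refine ⟨f, fun v j => ?_⟩
  have hmin := hf (Function.update f v j)
  rw [sum_sum_eq_sum_erase_add_two_mul _ (w_symm _) v (by simp [w]),
    sum_sum_eq_sum_erase_add_two_mul _ (w_symm _) v (by simp [w])] at hmin
  have rest : ∑ x ∈ Finset.univ.erase v, ∑ y ∈ Finset.univ.erase v,
        w (Function.update f v j) x y =
      ∑ x ∈ Finset.univ.erase v, ∑ y ∈ Finset.univ.erase v, w f x y := by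
    refine Finset.sum_congr rfl fun x hx => Finset.sum_congr rfl fun y hy => ?_
    simp only [w, Function.update_of_ne (Finset.ne_of_mem_erase hx),
      Function.update_of_ne (Finset.ne_of_mem_erase hy)]
  have row : ∑ y, w (Function.update f v j) v y =
      (Finset.univ.filter fun u => G.Adj v u ∧ f u = j).card := by
    rw [Finset.card_filter]
    refine Finset.sum_congr rfl fun y _ => ?_
    rcases eq_or_ne y v with rfl | hy
    · simp [w]
    · simp [w, Function.update_of_ne hy]
  rw [rest, row] at hmin
  rw [Finset.card_filter]
  change ∑ y, w f v y ≤ _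
  omega

/-- **Lemma 3 (Lovász).** For every finite undirected graph `G` and every `k ≥ 1`,
the vertex set admits a partition into `k` classes such that every vertex `v` has
degree at most `(1/k)·deg_G(v)` inside its own class. -/
theorem lovasz_partition {V : Type*} [Fintype V] (G : SimpleGraph V)
    (k : ℕ) (hk : 0 < k) :
    ∃ f : V → Fin k, ∀ v : V,
      ({u | G.Adj v u ∧ f u = f v}.ncard : ℝ) ≤ (1 / (k : ℝ)) * ({u | G.Adj v u}.ncard : ℝ) := by
  classical
  obtain ⟨f, hf⟩ := G.exists_forall_card_adj_le hk
  refine ⟨f, fun v => ?_⟩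
  have hdeg : (Finset.univ.filter fun u => G.Adj v u).card =
      ∑ j, (Finset.univ.filter fun u => G.Adj v u ∧ f u = j).card := by
    rw [Finset.card_eq_sum_card_fiberwise (f := f) (t := Finset.univ) (by simp)]
    simp only [Finset.filter_filter]
  have hmul : k * (Finset.univ.filter fun u => G.Adj v u ∧ f u = f v).card ≤
      (Finset.univ.filter fun u => G.Adj v u).card := by
    rw [hdeg]
    simpa using Finset.card_nsmul_le_sum Finset.univ _ _ fun j _ => hf v j
  rw [one_div_mul_eq_div, le_div_iff₀' (by exact_mod_cast hk), Set.ncard_eq_toFinset_card',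
    Set.ncard_eq_toFinset_card', Set.toFinset_ofPred, Set.toFinset_ofPred]
  exact_mod_cast hmul
end

section
/- Let g ≥ 2 be a natural number and let H be a digraph (finite, without loops or parallel arcs) with digirth at least 2g−1 and maximum degree Δ(H) ≤ 3g−1. Then the dichromatic number of H satisfies χ⃗(H) ≤ g+1. -/
open Classical in
/-- If the fibres of `p` on `U` over `I` have no independent transversal, but those over
`I.erase i₀` do, then a set of fibres including that of `i₀` is dominated by few vertices. -/
theorem exists_dominating {V ι : Type*} [Finite V] (n : ℕ) :
    ∀ (G : SimpleGraph V) (p : V → ι) (U : Set V) (I : Finset ι) (i₀ : ι),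
      I.card + G.edgeSet.ncard = n → i₀ ∈ I →
      (¬ ∃ t : ι → V, (∀ i ∈ I, t i ∈ U ∧ p (t i) = i) ∧ ∀ i ∈ I, ∀ j ∈ I, ¬ G.Adj (t i) (t j)) →
      (∃ t : ι → V, (∀ i ∈ I.erase i₀, t i ∈ U ∧ p (t i) = i) ∧
        ∀ i ∈ I.erase i₀, ∀ j ∈ I.erase i₀, ¬ G.Adj (t i) (t j)) →
      ∃ S ⊆ I, i₀ ∈ S ∧ ∃ Z : Finset V, Z.card + 2 ≤ 2 * S.card ∧
        ∀ v ∈ U, p v ∈ S → ∃ z ∈ Z, G.Adj z v := by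
  induction n using Nat.strong_induction_on with
  | _ n ih =>
  intro G p U I i₀ hn hi₀ hno hT
  obtain ⟨t, htU, ht⟩ := hT
  by_cases hx : ∃ x ∈ U, p x = i₀
  swap
  · exact ⟨{i₀}, by simpa, by simp, ∅, by simp,
      fun v hv hp => (hx ⟨v, hv, by simpa using hp⟩).elim⟩
  obtain ⟨x, hxU, hpx⟩ := hx
  -- `x` conflicts with the partial transversal
  have hb : ∃ b ∈ I.erase i₀, G.Adj x (t b) := by
    by_contra! h
    refine hno ⟨Function.update t i₀ x, fun i hi => ?_, fun i hi j hj => ?_⟩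
    · by_cases h' : i = i₀
      · subst h'; simp [hxU, hpx]
      · simpa [h'] using htU i (by simp [h', hi])
    · by_cases h₁ : i = i₀ <;> by_cases h₂ : j = i₀
      · simp [h₁, h₂]
      · simpa [h₁, h₂] using h j (by simp [h₂, hj])
      · simpa [h₁, h₂] using fun h' => h i (by simp [h₁, hi]) (SimpleGraph.Adj.symm h')
      · simpa [h₁, h₂] using ht i (by simp [h₁, hi]) j (by simp [h₂, hj])
  obtain ⟨b, hbI, hxy⟩ := hb
  obtain ⟨hyU, hpy⟩ := htU b hbI
  set y := t b with hy
  have hbi : b ≠ i₀ := Finset.ne_of_mem_erase hbI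
  have hbI' : b ∈ I := Finset.mem_of_mem_erase hbI
  by_cases hdel : ∃ s : ι → V, (∀ i ∈ I, s i ∈ U ∧ p (s i) = i) ∧
      ∀ i ∈ I, ∀ j ∈ I, ¬ (G.deleteEdges {s(x, y)}).Adj (s i) (s j)
  swap
  · obtain ⟨S, hS, hiS, Z, hZ, hdom⟩ := ih _ (by
      rw [← hn]
      refine Nat.add_lt_add_left (Set.ncard_lt_ncard ?_ (Set.toFinite _)) _
      rw [SimpleGraph.edgeSet_deleteEdges]
      refine ⟨Set.sdiff_subset, fun h => ?_⟩
      exact (h (show s(x, y) ∈ G.edgeSet from hxy)).2 rfl) (G.deleteEdges {s(x, y)}) p U I i₀ rfl hi₀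
      hdel ⟨t, htU, fun i hi j hj h => ht i hi j hj (SimpleGraph.deleteEdges_adj.1 h).1⟩
    refine ⟨S, hS, hiS, Z, hZ, fun v hv hp => ?_⟩
    obtain ⟨z, hz, h⟩ := hdom v hv hp
    exact ⟨z, hz, (SimpleGraph.deleteEdges_adj.1 h).1⟩
  obtain ⟨s, hsU, hs⟩ := hdel
  have hsxy : s i₀ = x ∧ s b = y := by
    by_contra hne
    refine hno ⟨s, hsU, fun i hi j hj hadj => ?_⟩
    have := hs i hi j hj
    rw [SimpleGraph.deleteEdges_adj] at this
    have h : s(s i, s j) = s(x, y) := by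
      by_contra h; exact this ⟨hadj, h⟩
    have hpi := (hsU i hi).2
    have hpj := (hsU j hj).2
    rcases Sym2.eq_iff.1 h with ⟨h₁, h₂⟩ | ⟨h₁, h₂⟩
    · rw [h₁, hpx] at hpi
      rw [h₂, hpy] at hpj
      subst hpi hpj
      exact hne ⟨h₁, h₂⟩
    · rw [h₁, hpy] at hpi
      rw [h₂, hpx] at hpj
      subst hpi hpj
      exact hne ⟨h₂, h₁⟩
  -- merge the parts `i₀` and `b`, and delete all neighbours of `x` and `y`
  set p' : V → ι := fun v => if p v = b then i₀ else p v with hp'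
  have hp'_eq : ∀ v i, i ≠ i₀ → p' v = i → p v = i := by
    intro v i hi h
    simp only [hp'] at h
    split_ifs at h with h'
    · exact (hi h.symm).elim
    · exact h
  obtain ⟨S, hS, hiS, Z, hZ, hdom⟩ := ih _ (by
      rw [← hn]
      exact Nat.add_lt_add_right (Finset.card_erase_lt_of_mem hbI') _) G p'
      {v ∈ U | ¬ G.Adj x v ∧ ¬ G.Adj y v} (I.erase b) i₀ rfl (by simp [hi₀, hbi.symm])
      (by
        rintro ⟨t', ht'U, ht'⟩
        have hz := ht'U i₀ (by simp [hi₀, hbi.symm])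
        by_cases hzb : p (t' i₀) = b
        · refine hno ⟨Function.update (Function.update t' i₀ x) b (t' i₀), ?_, ?_⟩
          · intro i hi
            by_cases h₁ : i = b
            · subst h₁; simpa using ⟨hz.1.1, hzb⟩
            by_cases h₂ : i = i₀
            · subst h₂; simp [h₁, hxU, hpx]
            · have := ht'U i (by simp [h₁, hi])
              simpa [h₁, h₂] using ⟨this.1.1, hp'_eq _ _ h₂ this.2⟩
          · have key : ∀ i ∈ I, ∀ j ∈ I, i = b ∨ i ≠ i₀ →
                ¬ G.Adj (Function.update (Function.update t' i₀ x) b (t' i₀) i)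
                  (Function.update (Function.update t' i₀ x) b (t' i₀) j) := by
              have hmem : ∀ i ∈ I, i = b ∨ i ≠ i₀ → ∃ i' ∈ I.erase b,
                  Function.update (Function.update t' i₀ x) b (t' i₀) i = t' i' := by
                intro i hi h
                by_cases h₁ : i = b
                · exact ⟨i₀, by simp [hi₀, hbi.symm], by simp [h₁]⟩
                · have h₂ := h.resolve_left h₁
                  exact ⟨i, by simp [h₁, hi], by simp [h₁, h₂]⟩
              intro i hi j hj h
              obtain ⟨i', hi', hei⟩ := hmem i hi h
              rw [hei]
              by_cases hj' : j = b ∨ j ≠ i₀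
              · obtain ⟨j', hj', hej⟩ := hmem j hj hj'
                rw [hej]
                exact ht' _ hi' _ hj'
              · push Not at hj'
                simp only [hj'.2, ne_eq, hbi.symm, not_false_eq_true, Function.update_of_ne,
                  Function.update_self]
                exact fun h => (ht'U _ hi').1.2.1 h.symm
            intro i hi j hj h
            by_cases hi' : i = b ∨ i ≠ i₀
            · exact key i hi j hj hi' h
            by_cases hj' : j = b ∨ j ≠ i₀
            · exact key j hj i hi hj' h.symm
            · push Not at hi' hj'
              rw [hi'.2, hj'.2] at h
              exact G.loopless.irrefl _ h
        · refine hno ⟨Function.update t' b y, ?_, ?_⟩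
          · intro i hi
            by_cases h₁ : i = b
            · subst h₁; simp [hyU, hpy]
            by_cases h₂ : i = i₀
            · have := hz.2
              simp only [hp', hzb, if_false] at this
              subst h₂; simpa [h₁] using ⟨hz.1.1, this⟩
            · have := ht'U i (by simp [h₁, hi])
              simpa [h₁] using ⟨this.1.1, hp'_eq _ _ h₂ this.2⟩
          · intro i hi j hj
            by_cases h₁ : i = b <;> by_cases h₂ : j = b
            · simp [h₁, h₂]
            · simpa [h₁, h₂] using (ht'U j (by simp [h₂, hj])).1.2.2
            · simpa [h₁, h₂] using fun h => (ht'U i (by simp [h₁, hi])).1.2.2 (SimpleGraph.Adj.symm h)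
            · simpa [h₁, h₂] using ht' i (by simp [h₁, hi]) j (by simp [h₂, hj]))
      ⟨s, fun i hi => by
        simp only [Finset.mem_erase] at hi
        obtain ⟨h₁, h₂, h₃⟩ := hi
        have hne : ∀ j ∈ I, i ≠ j → s(s j, s i) ≠ s(x, y) := by
          intro j hj hij h
          have h' : s i = x ∨ s i = y := by
            have : s i ∈ s(x, y) := h ▸ Sym2.mem_mk_right _ _
            simpa using this
          have hpi := (hsU i h₃).2
          rcases h' with h' | h'
          · rw [h', hpx] at hpi; exact h₁ hpi.symm
          · rw [h', hpy] at hpi; exact h₂ hpi.symm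
        have hadj : ∀ j ∈ I, i ≠ j → ¬ G.Adj (s j) (s i) := fun j hj hij h =>
          hs j hj i h₃ (SimpleGraph.deleteEdges_adj.2 ⟨h, by simpa using hne j hj hij⟩)
        refine ⟨⟨(hsU i h₃).1, ?_, ?_⟩, ?_⟩
        · simpa [hsxy.1] using hadj i₀ hi₀ h₁
        · simpa [hsxy.2] using hadj b hbI' h₂
        · simp [hp', (hsU i h₃).2, h₂],
        fun i hi j hj h => by
          simp only [Finset.mem_erase] at hi hj
          refine hs i hi.2.2 j hj.2.2 (SimpleGraph.deleteEdges_adj.2 ⟨h, fun h' => ?_⟩)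
          have h' : s i = x ∨ s i = y := by
            have : s i ∈ s(x, y) := (Set.mem_singleton_iff.1 h') ▸ Sym2.mem_mk_left _ _
            simpa using this
          have hpi := (hsU i hi.2.2).2
          rcases h' with h' | h'
          · rw [h', hpx] at hpi; exact hi.1 hpi.symm
          · rw [h', hpy] at hpi; exact hi.2.1 hpi.symm⟩
  have hbS : b ∉ S := fun h => by simpa using hS h
  refine ⟨insert b S, ?_, by simp [hiS], insert x (insert y Z), ?_, ?_⟩
  · intro i hi
    rcases Finset.mem_insert.1 hi with rfl | hi
    · exact hbI'
    · exact Finset.mem_of_mem_erase (hS hi)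
  · have h₁ := Finset.card_insert_le x (insert y Z)
    have h₂ := Finset.card_insert_le y Z
    rw [Finset.card_insert_of_notMem hbS]
    omega
  · intro v hv hpv
    by_cases hvx : G.Adj x v
    · exact ⟨x, by simp, hvx⟩
    by_cases hvy : G.Adj y v
    · exact ⟨y, by simp, hvy⟩
    obtain ⟨z, hz, h⟩ := hdom v ⟨hv, hvx, hvy⟩ (by
      by_cases h : p v = b
      · simpa [hp', h] using hiS
      · simpa [hp', h] using hpv)
    exact ⟨z, by simp [hz], h⟩

open Classical in
/-- Haxell's theorem: in a graph of maximum degree at most `k`, disjoint parts of more than `2 * k`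
vertices have an independent transversal. -/
theorem exists_independent_transversal {V ι : Type*} [Fintype V] [Nonempty V] (G : SimpleGraph V)
    (p : V → ι) (U : Set V) (k : ℕ) (hdeg : ∀ v, G.degree v ≤ k) (I : Finset ι)
    (hsize : ∀ i ∈ I, 2 * k < (Finset.univ.filter fun v => v ∈ U ∧ p v = i).card) :
    ∃ t : ι → V, (∀ i ∈ I, t i ∈ U ∧ p (t i) = i) ∧ ∀ i ∈ I, ∀ j ∈ I, ¬ G.Adj (t i) (t j) := by
  induction I using Finset.induction_on with
  | empty => exact ⟨fun _ => Classical.arbitrary V, by simp, by simp⟩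
  | insert i₀ I hi₀ ih =>
    by_contra hno
    obtain ⟨S, hS, hiS, Z, hZ, hdom⟩ := exists_dominating _ G p U (insert i₀ I) i₀ rfl (by simp)
      hno (by
        rw [Finset.erase_insert hi₀]
        exact ih fun i hi => hsize i (Finset.mem_insert_of_mem hi))
    have h₁ : S.card * (2 * k + 1) ≤ (Finset.univ.filter fun v => v ∈ U ∧ p v ∈ S).card := by
      rw [Finset.card_eq_sum_card_fiberwise (f := p) (t := S) (fun v hv => by simp_all)]
      rw [← smul_eq_mul]
      refine Finset.card_nsmul_le_sum _ _ _ fun i hi => (hsize i (hS hi)).trans_le ?_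
      refine Finset.card_le_card fun v hv => ?_
      simp_all
    have h₂ : (Finset.univ.filter fun v => v ∈ U ∧ p v ∈ S).card ≤ Z.card * k := by
      refine (Finset.card_le_card (t := Z.biUnion fun z => G.neighborFinset z) fun v hv => ?_).trans
        (Finset.card_biUnion_le_card_mul _ _ _ fun z _ => hdeg z)
      simp only [Finset.mem_filter, Finset.mem_univ, true_and] at hv
      obtain ⟨z, hz, h⟩ := hdom v hv.1 hv.2
      exact Finset.mem_biUnion.2 ⟨z, hz, by simpa using h⟩
    have h₃ : 1 ≤ S.card := Finset.card_pos.2 ⟨_, hiS⟩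
    nlinarith

/-- A directed cycle, unrolled to a periodic sequence. -/
theorem IsDiCycle.exists_seq {V : Type*} {A : V → V → Prop} {l : List V} (hl : IsDiCycle A l) :
    ∃ f : ℕ → V, (∀ i, f i ∈ l) ∧ (∀ x ∈ l, ∃ i, f i = x) ∧ (∀ i, A (f i) (f (i + 1))) ∧
      ∀ i, f (i + l.length) = f i := by
  obtain ⟨hne, -, hch, hlast⟩ := hl
  have hpos : 0 < l.length := List.length_pos_iff.2 hne
  have hmod : ∀ i, i % l.length < l.length := fun i => Nat.mod_lt _ hpos
  refine ⟨fun i => l[i % l.length]'(hmod i), fun i => List.getElem_mem _, fun x hx => ?_,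
    fun i => ?_, fun i => by simp⟩
  · obtain ⟨i, hi, rfl⟩ := List.mem_iff_getElem.1 hx
    exact ⟨i, by simp [Nat.mod_eq_of_lt hi]⟩
  · by_cases h : i % l.length + 1 < l.length
    · have h' : (i + 1) % l.length = i % l.length + 1 := by
        rw [← Nat.mod_add_mod, Nat.mod_eq_of_lt h]
      simp only [h']
      exact List.isChain_iff_getElem.1 hch _ h
    · have h₀ : i % l.length + 1 = l.length := by have := hmod i; omega
      have h₁ : (i + 1) % l.length = 0 := by rw [← Nat.mod_add_mod, h₀, Nat.mod_self]
      have h₂ : i % l.length = l.length - 1 := by omega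
      have := hlast hne
      rw [List.getLast_eq_getElem, List.head_eq_getElem] at this
      simpa only [h₁, h₂] using this

theorem IsDiCycle.reflTransGen {V : Type*} {A : V → V → Prop} {l : List V} (hl : IsDiCycle A l)
    {x y : V} (hx : x ∈ l) (hy : y ∈ l) : Relation.ReflTransGen A x y := by
  obtain ⟨f, -, hsurj, hA, hper⟩ := hl.exists_seq
  obtain ⟨i, rfl⟩ := hsurj x hx
  obtain ⟨j, rfl⟩ := hsurj y hy
  have hpos : 0 < l.length := List.length_pos_iff.2 hl.1
  have hstep : ∀ m, Relation.ReflTransGen A (f i) (f (i + m)) := fun m => by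
    induction m with
    | zero => exact .refl
    | succ m ih => exact ih.tail (hA _)
  have hper' : ∀ m, f (j + m * l.length) = f j := fun m => by
    induction m with
    | zero => simp
    | succ m ih => rw [Nat.succ_mul, ← Nat.add_assoc, hper, ih]
  have := hstep (j + i * l.length - i)
  rwa [Nat.add_sub_cancel' (by nlinarith), hper'] at this

/-- No potential strictly increases around a directed cycle. -/
theorem IsDiCycle.exists_backward {V : Type*} {A : V → V → Prop} {l : List V}
    (hl : IsDiCycle A l) (r : V → ℕ) : ∃ x ∈ l, ∃ y ∈ l, A x y ∧ r y ≤ r x := by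
  obtain ⟨f, hf, -, hA, hper⟩ := hl.exists_seq
  by_contra! h
  have hmono : StrictMono (r ∘ f) :=
    strictMono_nat_of_lt_succ fun i => h _ (hf _) _ (hf _) (hA i)
  have hpos : 0 < l.length := List.length_pos_iff.2 hl.1
  exact (hmono (show 0 < 0 + l.length by omega)).ne (by simpa using congrArg r (hper 0).symm)

theorem IsDiCycle.imp_of_mem {V : Type*} {A B : V → V → Prop} {l : List V} (hl : IsDiCycle A l)
    (h : ∀ x ∈ l, ∀ y ∈ l, A x y → B x y) : IsDiCycle B l := by
  refine ⟨hl.1, hl.2.1, ?_, fun hne =>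
    h _ (List.getLast_mem hne) _ (List.head_mem hne) (hl.2.2.2 hne)⟩
  exact List.isChain_iff_getElem.2 fun i hi =>
    h _ (List.getElem_mem _) _ (List.getElem_mem _) (List.isChain_iff_getElem.1 hl.2.2.1 i hi)

theorem isDiCycle_pair {V : Type*} {A : V → V → Prop} {x y : V} (hne : x ≠ y) (hxy : A x y)
    (hyx : A y x) : IsDiCycle A [x, y] :=
  ⟨by simp, by simpa using hne, show List.IsChain A [x, y] by simpa using hxy,
    by simpa using hyx⟩

theorem isDiCycle_triple {V : Type*} {A : V → V → Prop} {x y z : V} (hxy' : x ≠ y) (hyz' : y ≠ z)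
    (hzx' : z ≠ x) (hxy : A x y) (hyz : A y z) (hzx : A z x) : IsDiCycle A [x, y, z] :=
  ⟨by simp, by simp [hxy', hyz', hzx'.symm],
    show List.IsChain A [x, y, z] by simp [hxy, hyz], by simpa using hzx⟩

theorem card_filter_prod_eq {V : Type*} [Fintype V] [DecidableEq V] (P : V → V → Prop)
    [∀ a b, Decidable (P a b)] (v : V) (hv : ¬ P v v) :
    (Finset.univ.filter fun q : V × V => P q.1 q.2).card =
      (Finset.univ.filter fun q : V × V => (q.1 ≠ v ∧ q.2 ≠ v) ∧ P q.1 q.2).card +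
        (Finset.univ.filter fun u => P v u).card + (Finset.univ.filter fun u => P u v).card := by
  rw [← Finset.card_image_of_injective (Finset.univ.filter fun u => P v u)
      (f := fun u => (v, u)) (fun a b h => by simpa using h),
    ← Finset.card_image_of_injective (Finset.univ.filter fun u => P u v)
      (f := fun u => (u, v)) (fun a b h => by simpa using h),
    ← Finset.card_union_of_disjoint, ← Finset.card_union_of_disjoint]
  · congr 1
    ext ⟨a, b⟩
    simp only [Finset.mem_filter, Finset.mem_univ, true_and, Finset.mem_union, Finset.mem_image,
      Prod.mk.injEq]
    constructor
    · intro h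
      by_cases ha : a = v
      · exact .inl (.inr ⟨b, ha ▸ h, ha.symm, rfl⟩)
      by_cases hb : b = v
      · exact .inr ⟨a, hb ▸ h, rfl, hb.symm⟩
      · exact .inl (.inl ⟨⟨ha, hb⟩, h⟩)
    · rintro ((h | ⟨u, h, rfl, rfl⟩) | ⟨u, h, rfl, rfl⟩)
      exacts [h.2, h, h]
  · rw [Finset.disjoint_left]
    rintro ⟨a, b⟩ h₁ h₂
    simp only [Finset.mem_filter, Finset.mem_univ, true_and, Finset.mem_union, Finset.mem_image,
      Prod.mk.injEq] at h₁ h₂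
    obtain ⟨u, hu, rfl, rfl⟩ := h₂
    rcases h₁ with h | ⟨w, hw, rfl, rfl⟩
    · exact h.1.2 rfl
    · exact hv hw
  · rw [Finset.disjoint_left]
    rintro ⟨a, b⟩ h₁ h₂
    simp only [Finset.mem_filter, Finset.mem_univ, true_and, Finset.mem_image,
      Prod.mk.injEq] at h₁ h₂
    obtain ⟨u, hu, rfl, rfl⟩ := h₂
    exact h₁.1.1 rfl

open Classical in
/-- Every loopless digraph has an ordering in which the number of backward arcs at each vertex is
at most both its out-degree and its in-degree. -/
theorem exists_potential {V : Type*} [Fintype V] (A : V → V → Prop) (hA : ∀ v, ¬ A v v) :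
    ∃ r : V → ℕ, ∀ v,
      (Finset.univ.filter fun u => A v u ∧ r u ≤ r v).card +
        (Finset.univ.filter fun u => A u v ∧ r v ≤ r u).card ≤
      min (Finset.univ.filter fun u => A v u).card (Finset.univ.filter fun u => A u v).card := by
  let F : (V → ℕ) → ℕ := fun r =>
    (Finset.univ.filter fun q : V × V => A q.1 q.2 ∧ r q.2 ≤ r q.1).card
  obtain ⟨r, hr⟩ : ∃ r, ∀ r', F r ≤ F r' :=
    ⟨Function.argmin F, fun r' => Function.argmin_le F r'⟩
  have hF : ∀ r v, F r = (Finset.univ.filter fun q : V × V =>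
      (q.1 ≠ v ∧ q.2 ≠ v) ∧ A q.1 q.2 ∧ r q.2 ≤ r q.1).card +
        (Finset.univ.filter fun u => A v u ∧ r u ≤ r v).card +
        (Finset.univ.filter fun u => A u v ∧ r v ≤ r u).card := fun r v =>
    card_filter_prod_eq (fun a b => A a b ∧ r b ≤ r a) v fun h => hA v h.1
  refine ⟨r, fun v => le_min ?_ ?_⟩
  · -- compare with moving `v` to the end
    let r' : V → ℕ := Function.update r v (∑ u, r u + 1)
    have hr' : ∀ u, u ≠ v → r' u = r u := fun u hu => Function.update_of_ne hu _ _
    have h := hr r'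
    rw [hF r v, hF r' v] at h
    have h₁ : (Finset.univ.filter fun q : V × V =>
        (q.1 ≠ v ∧ q.2 ≠ v) ∧ A q.1 q.2 ∧ r' q.2 ≤ r' q.1).card =
        (Finset.univ.filter fun q : V × V =>
        (q.1 ≠ v ∧ q.2 ≠ v) ∧ A q.1 q.2 ∧ r q.2 ≤ r q.1).card := by
      congr 1
      refine Finset.filter_congr fun q _ => and_congr_right fun h => ?_
      rw [hr' _ h.1, hr' _ h.2]
    have h₂ : (Finset.univ.filter fun u => A v u ∧ r' u ≤ r' v).card ≤
        (Finset.univ.filter fun u => A v u).card :=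
      Finset.card_le_card fun u hu => by simp_all
    have h₃ : (Finset.univ.filter fun u => A u v ∧ r' v ≤ r' u).card = 0 := by
      rw [Finset.card_eq_zero, Finset.filter_eq_empty_iff]
      rintro u - ⟨hu, hle⟩
      have hne : u ≠ v := fun h => hA v (h ▸ hu)
      rw [hr' u hne, show r' v = ∑ u, r u + 1 from Function.update_self ..] at hle
      have := Finset.single_le_sum (f := r) (fun _ _ => Nat.zero_le _) (Finset.mem_univ u)
      omega
    omega
  · -- compare with moving `v` to the front
    let r' : V → ℕ := fun u => if u = v then 0 else r u + 1
    have hr' : ∀ u, u ≠ v → r' u = r u + 1 := fun u hu => if_neg hu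
    have h := hr r'
    rw [hF r v, hF r' v] at h
    have h₁ : (Finset.univ.filter fun q : V × V =>
        (q.1 ≠ v ∧ q.2 ≠ v) ∧ A q.1 q.2 ∧ r' q.2 ≤ r' q.1).card =
        (Finset.univ.filter fun q : V × V =>
        (q.1 ≠ v ∧ q.2 ≠ v) ∧ A q.1 q.2 ∧ r q.2 ≤ r q.1).card := by
      congr 1
      refine Finset.filter_congr fun q _ => and_congr_right fun h => ?_
      rw [hr' _ h.1, hr' _ h.2, Nat.add_le_add_iff_right]
    have h₂ : (Finset.univ.filter fun u => A u v ∧ r' v ≤ r' u).card ≤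
        (Finset.univ.filter fun u => A u v).card :=
      Finset.card_le_card fun u hu => by simp_all
    have h₃ : (Finset.univ.filter fun u => A v u ∧ r' u ≤ r' v).card = 0 := by
      rw [Finset.card_eq_zero, Finset.filter_eq_empty_iff]
      rintro u - ⟨hu, hle⟩
      have hne : u ≠ v := fun h => hA v (h ▸ hu)
      rw [hr' u hne, show r' v = 0 from if_pos rfl] at hle
      omega
    omega

open Classical in
/-- The number of neighbours of `v` of colour `j`. -/
noncomputable def colorDegree {V K : Type*} [Fintype V] (G : SimpleGraph V) (c : V → K) (v : V)
    (j : K) : ℕ :=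
  (Finset.univ.filter fun u => G.Adj v u ∧ c u = j).card

open Classical in
/-- The number of ordered monochromatic adjacent pairs. -/
noncomputable def monoPairs {V K : Type*} [Fintype V] (G : SimpleGraph V) (c : V → K) : ℕ :=
  (Finset.univ.filter fun q : V × V => G.Adj q.1 q.2 ∧ c q.1 = c q.2).card

open Classical in
theorem monoPairs_update {V K : Type*} [Fintype V] (G : SimpleGraph V) (c : V → K) (v : V)
    (j : K) : monoPairs G (Function.update c v j) + 2 * colorDegree G c v (c v) =
      monoPairs G c + 2 * colorDegree G c v j := by
  have key : ∀ d : V → K, (∀ u, u ≠ v → d u = c u) → monoPairs G d =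
      (Finset.univ.filter fun q : V × V =>
        (q.1 ≠ v ∧ q.2 ≠ v) ∧ G.Adj q.1 q.2 ∧ c q.1 = c q.2).card +
          2 * colorDegree G c v (d v) := by
    intro d hd
    rw [monoPairs, card_filter_prod_eq (fun a b => G.Adj a b ∧ d a = d b) v (by simp), colorDegree,
      two_mul, ← Nat.add_assoc]
    congr 1
    · congr 1
      · congr 1
        refine Finset.filter_congr fun q _ => ?_
        refine and_congr_right fun h => ?_
        rw [hd _ h.1, hd _ h.2]
      · congr 1
        refine Finset.filter_congr fun u _ => and_congr_right fun h => ?_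
        rw [hd u h.ne', eq_comm]
    · congr 1
      refine Finset.filter_congr fun u _ => ?_
      rw [G.adj_comm]
      refine and_congr_right fun h => ?_
      rw [hd u h.ne']
  rw [key _ fun u hu => Function.update_of_ne hu _ _, key c fun _ _ => rfl, Function.update_self]
  omega

open Classical in
theorem sum_colorDegree {V K : Type*} [Fintype V] [Fintype K] (G : SimpleGraph V) (c : V → K)
    (v : V) : ∑ j, colorDegree G c v j = G.degree v := by
  rw [← G.card_neighborFinset_eq_degree, Finset.card_eq_sum_card_fiberwise (f := c) (t := Finset.univ)
    (by simp)]
  refine Finset.sum_congr rfl fun j _ => ?_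
  rw [colorDegree]
  congr 1
  ext u
  simp

theorem exists_colorDegree_le_two {V K : Type*} [Fintype V] [Fintype K] (G : SimpleGraph V)
    (c : V → K) (v : V) (hdeg : ∑ j, colorDegree G c v j < 3 * Fintype.card K) :
    ∃ j, colorDegree G c v j ≤ 2 := by
  by_contra! h
  have := Finset.card_nsmul_le_sum Finset.univ (fun j => colorDegree G c v j) 3 fun j _ => h j
  simp only [Finset.card_univ, smul_eq_mul] at this
  omega

theorem colorDegree_self_le_two {V K : Type*} [Fintype V] [Fintype K] (G : SimpleGraph V)
    (c : V → K) (hdeg : ∀ (c : V → K) v, ∑ j, colorDegree G c v j < 3 * Fintype.card K)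
    (hmin : ∀ d : V → K, monoPairs G c ≤ monoPairs G d) (v : V) :
    colorDegree G c v (c v) ≤ 2 := by
  classical
  obtain ⟨j, hj⟩ := exists_colorDegree_le_two G c v (hdeg c v)
  have h₁ := monoPairs_update G c v j
  have h₂ := hmin (Function.update c v j)
  omega

theorem colorDegree_self_le {V K : Type*} [Fintype V] (G : SimpleGraph V) (c : V → K)
    (hmin : ∀ d : V → K, monoPairs G c ≤ monoPairs G d) (v : V) (j : K) :
    colorDegree G c v (c v) ≤ colorDegree G c v j := by
  classical
  have h₁ := monoPairs_update G c v j
  have h₂ := hmin (Function.update c v j)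
  omega

theorem colorDegree_update_of_adj {V K : Type*} [Fintype V] [DecidableEq V] (G : SimpleGraph V)
    (c : V → K) {u v : V} {j : K} (huv : G.Adj u v) (hj : c v ≠ j) :
    colorDegree G (Function.update c v j) u j = colorDegree G c u j + 1 := by
  classical
  have hv : v ∉ Finset.univ.filter fun w => G.Adj u w ∧ c w = j := by simp [hj]
  rw [colorDegree, colorDegree, ← Finset.card_insert_of_notMem hv]
  congr 1
  ext w
  by_cases h : w = v
  · simp [h, huv]
  · simp [h]

theorem colorDegree_update_of_not_adj {V K : Type*} [Fintype V] [DecidableEq V]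
    (G : SimpleGraph V) (c : V → K) {u v : V} (j k : K) (huv : ¬ G.Adj u v) :
    colorDegree G (Function.update c v k) u j = colorDegree G c u j := by
  classical
  rw [colorDegree, colorDegree]
  congr 1
  refine Finset.filter_congr fun w _ => and_congr_right fun hw => ?_
  have hwv : w ≠ v := by
    rintro rfl
    exact huv hw
  rw [Function.update_of_ne hwv]

theorem eq_or_eq_of_colorDegree_le_two {V K : Type*} [Fintype V] {G : SimpleGraph V}
    {c : V → K} {v a b y : V} {j : K} (hv : colorDegree G c v j ≤ 2) (hab : a ≠ b)
    (ha : G.Adj v a) (hca : c a = j) (hb : G.Adj v b) (hcb : c b = j)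
    (hy : G.Adj v y) (hcy : c y = j) : y = a ∨ y = b := by
  classical
  by_contra! h
  have h₃ : ({y, a, b} : Finset V).card = 3 := Finset.card_eq_three.2 ⟨y, a, b, h.1, h.2, hab, rfl⟩
  have : ({y, a, b} : Finset V).card ≤ colorDegree G c v j := by
    refine Finset.card_le_card fun w hw => ?_
    simp only [Finset.mem_insert, Finset.mem_singleton] at hw
    rcases hw with rfl | rfl | rfl <;> simp [*]
  omega

section Optimal

variable {V K : Type*} [Fintype V] [Fintype K] {G : SimpleGraph V} {c : V → K}

/-- In an optimal colouring, moving `v` to a colour where it has two neighbours is optimal again,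
so these neighbours had low degree in their class. -/
theorem colorDegree_le_one_of_eq_two
    (hdeg : ∀ (c : V → K) v, ∑ j, colorDegree G c v j < 3 * Fintype.card K)
    (hmin : ∀ d : V → K, monoPairs G c ≤ monoPairs G d) {v u : V} {j : K} (hj : c v ≠ j)
    (hv : colorDegree G c v (c v) = 2) (hvj : colorDegree G c v j = 2)
    (hu : G.Adj v u) (hcu : c u = j) : colorDegree G c u j ≤ 1 := by
  classical
  have h₁ := monoPairs_update G c v j
  have h₂ := colorDegree_self_le_two G (Function.update c v j) hdeg
    (fun d => by have := hmin d; omega) u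
  rw [Function.update_of_ne hu.ne', hcu, colorDegree_update_of_adj G c hu.symm hj] at h₂
  omega

/-- If `v` has three neighbours of colour `j`, then moving `v` to `j` and one of these neighbours
away keeps the colouring optimal. -/
theorem colorDegree_le_one_of_eq_three
    (hdeg : ∀ (c : V → K) v, ∑ j, colorDegree G c v j < 3 * Fintype.card K)
    (hmin : ∀ d : V → K, monoPairs G c ≤ monoPairs G d) {v u w : V} {j : K} (hj : c v ≠ j)
    (hv : colorDegree G c v (c v) = 2) (hvj : colorDegree G c v j = 3)
    (hu : G.Adj v u) (hcu : c u = j) (huj : colorDegree G c u j = 2)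
    (hw : G.Adj v w) (hcw : c w = j) (huw : u ≠ w) (hnadj : ¬ G.Adj u w) :
    colorDegree G c w j ≤ 1 := by
  classical
  set c₁ := Function.update c v j with hc₁
  have h₁ := monoPairs_update G c v j
  rw [← hc₁] at h₁
  have hc₁u : c₁ u = j := by rw [hc₁, Function.update_of_ne hu.ne', hcu]
  have hd₁u : colorDegree G c₁ u j = 3 := by
    rw [hc₁, colorDegree_update_of_adj G c hu.symm hj, huj]
  obtain ⟨k, hk⟩ := exists_colorDegree_le_two G c₁ u (hdeg c₁ u)
  have h₂ := monoPairs_update G c₁ u k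
  rw [hc₁u] at h₂
  have h₃ := colorDegree_self_le_two G (Function.update c₁ u k) hdeg
    (fun d => by have := hmin d; omega) w
  rw [Function.update_of_ne huw.symm, hc₁, Function.update_of_ne hw.ne', hcw,
    colorDegree_update_of_not_adj G _ _ _ (fun h => hnadj h.symm),
    colorDegree_update_of_adj G c hw.symm hj] at h₃
  omega

open Classical in
/-- In an optimal colouring, a vertex with two neighbours of its own colour has few differently
coloured neighbours of this kind. -/
theorem card_outer_neighbors_lt
    (hcard : 2 ≤ Fintype.card K)
    (hdeg : ∀ (c : V → K) v, ∑ j, colorDegree G c v j < 3 * Fintype.card K)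
    (hmin : ∀ d : V → K, monoPairs G c ≤ monoPairs G d) {W : Set V}
    (hW : ∀ v ∈ W, colorDegree G c v (c v) = 2)
    (htri : 3 ≤ Fintype.card K → ∀ x ∈ W, ∀ y ∈ W, ∀ z ∈ W, c x = c y → c y = c z →
      G.Adj x y → G.Adj y z → G.Adj x z → False) {v : V} (hv : v ∈ W) :
    (Finset.univ.filter fun u => G.Adj v u ∧ u ∈ W ∧ c v ≠ c u).card < 2 * Fintype.card K := by
  have key : ∀ j ∈ Finset.univ.erase (c v),
      (Finset.univ.filter fun u => G.Adj v u ∧ u ∈ W ∧ c u = j).card + 4 ≤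
        2 * colorDegree G c v j + if Fintype.card K = 2 then 1 else 0 := by
    intro j hj
    have hj' : c v ≠ j := (Finset.ne_of_mem_erase hj).symm
    have h₂ := colorDegree_self_le G c hmin v j
    rw [hW v hv] at h₂
    have hle : (Finset.univ.filter fun u => G.Adj v u ∧ u ∈ W ∧ c u = j).card ≤
        colorDegree G c v j := Finset.card_le_card fun u hu => by simp_all
    rcases Nat.lt_or_ge 3 (colorDegree G c v j) with h4 | h4
    · omega
    rcases (show colorDegree G c v j = 2 ∨ colorDegree G c v j = 3 by omega) with hd | hd
    · have : (Finset.univ.filter fun u => G.Adj v u ∧ u ∈ W ∧ c u = j).card = 0 := by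
        rw [Finset.card_eq_zero, Finset.filter_eq_empty_iff]
        rintro u - ⟨hu, huW, hcu⟩
        have h₁ := colorDegree_le_one_of_eq_two hdeg hmin hj' (hW v hv) hd hu hcu
        have h₂ := hW u huW
        rw [hcu] at h₂
        omega
      omega
    · by_cases hK : Fintype.card K = 2
      · simp only [hK, if_true]; omega
      by_contra hlt
      obtain ⟨x, y, z, hxy, hxz, hyz, he⟩ := Finset.card_eq_three.1
        (show (Finset.univ.filter fun u => G.Adj v u ∧ u ∈ W ∧ c u = j).card = 3 by omega)
      have hmem : ∀ u, u = x ∨ u = y ∨ u = z → G.Adj v u ∧ u ∈ W ∧ c u = j := fun u hu => by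
        have : u ∈ Finset.univ.filter fun u => G.Adj v u ∧ u ∈ W ∧ c u = j := by
          rw [he]; simpa using hu
        simpa using this
      have hadj : ∀ a b, (a = x ∨ a = y ∨ a = z) → (b = x ∨ b = y ∨ b = z) → a ≠ b →
          G.Adj a b := by
        intro a b ha hb hab
        obtain ⟨ha₁, ha₂, ha₃⟩ := hmem a ha
        obtain ⟨hb₁, hb₂, hb₃⟩ := hmem b hb
        by_contra hnadj
        have := colorDegree_le_one_of_eq_three hdeg hmin hj' (hW v hv) hd ha₁ ha₃
          (ha₃ ▸ hW a ha₂) hb₁ hb₃ hab hnadj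
        have h := hW b hb₂
        rw [hb₃] at h
        omega
      obtain ⟨-, hx₂, hx₃⟩ := hmem x (by simp)
      obtain ⟨-, hy₂, hy₃⟩ := hmem y (by simp)
      obtain ⟨-, hz₂, hz₃⟩ := hmem z (by simp)
      exact htri (by omega) x hx₂ y hy₂ z hz₂ (hx₃.trans hy₃.symm) (hy₃.trans hz₃.symm)
        (hadj x y (by simp) (by simp) hxy) (hadj y z (by simp) (by simp) hyz)
        (hadj x z (by simp) (by simp) hxz)
  have hsum := Finset.sum_le_sum key
  have hfib : (Finset.univ.filter fun u => G.Adj v u ∧ u ∈ W ∧ c v ≠ c u).card =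
      ∑ j ∈ Finset.univ.erase (c v),
        (Finset.univ.filter fun u => G.Adj v u ∧ u ∈ W ∧ c u = j).card := by
    rw [Finset.card_eq_sum_card_fiberwise (f := c) (t := Finset.univ.erase (c v))
      (fun u hu => by simp_all [eq_comm])]
    refine Finset.sum_congr rfl fun j hj => ?_
    congr 1
    ext u
    have hj' : j ≠ c v := Finset.ne_of_mem_erase hj
    simp only [Finset.mem_filter, Finset.mem_univ, true_and]
    constructor
    · rintro ⟨⟨h₁, h₂, -⟩, h₃⟩
      exact ⟨h₁, h₂, h₃⟩
    · rintro ⟨h₁, h₂, h₃⟩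
      exact ⟨⟨h₁, h₂, fun h => hj' (h₃.symm.trans h.symm)⟩, h₃⟩
  have htot := Finset.add_sum_erase Finset.univ (fun j => colorDegree G c v j)
    (Finset.mem_univ (c v))
  have hd := hdeg c v
  simp only [hW v hv] at htot
  rw [Finset.sum_add_distrib, Finset.sum_add_distrib, ← hfib, ← Finset.mul_sum] at hsum
  simp only [Finset.sum_const, Finset.card_erase_of_mem (Finset.mem_univ (c v)), Finset.card_univ,
    smul_eq_mul] at hsum
  split_ifs at hsum with hK
  · rw [hK] at hsum hd ⊢
    omega
  · omega

end Optimal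

open Classical in
/-- In a digraph of maximum degree at most `2 * k + 1`, disjoint parts of more than `2 * k` vertices
have an acyclic transversal. -/
theorem exists_acyclic_transversal_s5 {V : Type*} [Fintype V] [Nonempty V] (A : V → V → Prop)
    (hirr : ∀ v, ¬ A v v) (W : Set V) (p : V → Finset V)
    (k : ℕ)
    (hdeg : ∀ v, (Finset.univ.filter fun u => A v u).card +
      (Finset.univ.filter fun u => A u v).card < 2 * (k + 1))
    (hsize : ∀ v ∈ W, 2 * k < (Finset.univ.filter fun u => u ∈ W ∧ p u = p v).card) :
    ∃ T ⊆ W, (∀ v ∈ W, ∃ u ∈ T, p u = p v) ∧ (∀ u ∈ T, ∀ v ∈ T, p u = p v → u = v) ∧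
      AcyclicSet A T := by
  obtain ⟨r, hr⟩ := exists_potential A hirr
  obtain ⟨B, hBadj⟩ : ∃ B : SimpleGraph V, ∀ x y, B.Adj x y ↔
      x ≠ y ∧ ((A x y ∧ r y ≤ r x) ∨ (A y x ∧ r x ≤ r y)) :=
    ⟨SimpleGraph.fromRel fun x y => A x y ∧ r y ≤ r x, SimpleGraph.fromRel_adj _⟩
  have hB : ∀ v, B.degree v ≤ k := by
    intro v
    have h₁ := hr v
    have h₂ := hdeg v
    have h₃ : B.degree v ≤ (Finset.univ.filter fun u => A v u ∧ r u ≤ r v).card +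
        (Finset.univ.filter fun u => A u v ∧ r v ≤ r u).card := by
      rw [← B.card_neighborFinset_eq_degree]
      refine (Finset.card_le_card fun u hu => ?_).trans (Finset.card_union_le _ _)
      simp only [SimpleGraph.mem_neighborFinset, hBadj] at hu
      simpa using hu.2
    omega
  obtain ⟨t, ht, hind⟩ := exists_independent_transversal B p W k hB
    ((Finset.univ.filter fun v => v ∈ W).image p) (by
      intro i hi
      obtain ⟨v, hv, rfl⟩ := Finset.mem_image.1 hi
      convert hsize v (by simpa using hv))
  have hmem : ∀ v ∈ W, p v ∈ (Finset.univ.filter fun v => v ∈ W).image p := fun v hv =>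
    Finset.mem_image_of_mem _ (by simpa using hv)
  refine ⟨{u | ∃ v ∈ W, u = t (p v)}, ?_, ?_, ?_, ?_⟩
  · rintro u ⟨v, hv, rfl⟩
    exact (ht _ (hmem v hv)).1
  · exact fun v hv => ⟨_, ⟨v, hv, rfl⟩, (ht _ (hmem v hv)).2⟩
  · rintro u ⟨v, hv, rfl⟩ u' ⟨v', hv', rfl⟩ h
    rw [(ht _ (hmem v hv)).2, (ht _ (hmem v' hv')).2] at h
    rw [h]
  · intro l hl hcyc
    obtain ⟨x, hx, y, hy, hxy, hle⟩ := hcyc.exists_backward r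
    obtain ⟨v, hv, rfl⟩ := hl x hx
    obtain ⟨v', hv', rfl⟩ := hl y hy
    exact hind _ (hmem v hv) _ (hmem v' hv')
      ((hBadj _ _).2 ⟨fun h => hirr _ (h ▸ hxy), .inl ⟨hxy, hle⟩⟩)

/-- For `g ≥ 2`, every digraph `H` with digirth at least `2g - 1` and maximum degree
`Δ(H) ≤ 3g - 1` satisfies `χ⃗(H) ≤ g + 1`. -/
theorem dichromatic_le_of_small_maxDeg {V : Type*} [Fintype V]
    (A : V → V → Prop) (hirr : Irreflexive A)
    (g : ℕ) (hg : 2 ≤ g)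
    (hgirth : digirthGE A (2 * g - 1))
    (hΔ : maxDeg A ≤ 3 * g - 1) :
    dichromatic A ≤ g + 1 := by
  classical
  refine Nat.sInf_le ?_
  rcases isEmpty_or_nonempty V with hV | hV
  · exact ⟨isEmptyElim, fun i l _ hl => hV.false (l.head hl.1)⟩
  have : NeZero g := ⟨by omega⟩
  have hanti : ∀ x y, A x y → ¬ A y x := fun x y hxy hyx => by
    have := hgirth _ (isDiCycle_pair (by rintro rfl; exact hirr x hxy) hxy hyx)
    simp only [List.length_cons, List.length_nil] at this
    omega
  obtain ⟨G, hG⟩ : ∃ G : SimpleGraph V, ∀ x y, G.Adj x y ↔ A x y ∨ A y x :=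
    ⟨SimpleGraph.fromRel A, fun x y => (SimpleGraph.fromRel_adj _ _ _).trans
      ⟨fun h => h.2, fun h => ⟨by rintro rfl; exact hirr x (or_self_iff.1 h), h⟩⟩⟩
  have hdeg : ∀ (c : V → Fin g) v, ∑ j, colorDegree G c v j < 3 * Fintype.card (Fin g) := by
    intro c v
    have h₁ : undirDeg A v ≤ maxDeg A := Finset.le_sup (f := undirDeg A) (Finset.mem_univ v)
    have h₂ : undirDeg A v = G.degree v := by
      rw [undirDeg, ← G.card_neighborFinset_eq_degree, ← Set.ncard_coe_finset]
      congr 1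
      ext u
      simp [hG]
    rw [sum_colorDegree, Fintype.card_fin]
    omega
  obtain ⟨c, hmin⟩ : ∃ c : V → Fin g, ∀ d, monoPairs G c ≤ monoPairs G d :=
    ⟨Function.argmin (monoPairs G), fun d => Function.argmin_le (monoPairs G) d⟩
  have hle2 := colorDegree_self_le_two G c hdeg hmin
  -- the monochromatic arcs and the vertices on monochromatic directed cycles
  let M : V → V → Prop := fun x y => A x y ∧ c x = c y
  let W : Set V := {v | ∃ l, IsDiCycle M l ∧ v ∈ l}
  have hMA : ∀ l, IsDiCycle M l → IsDiCycle A l := fun l hl =>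
    hl.imp_of_mem fun _ _ _ _ h => h.1
  have hsucc : ∀ x ∈ W, ∃ y, M x y := fun x ⟨l, hl, hx⟩ =>
    (hl.exists_succ hx).imp fun _ h => h.2
  have hpred : ∀ x ∈ W, ∃ y, M y x := fun x ⟨l, hl, hx⟩ =>
    (hl.exists_pred hx).imp fun _ h => h.2
  have hnbr : ∀ {x a b y}, a ≠ b → G.Adj x a → c a = c x → G.Adj x b → c b = c x →
      G.Adj x y → c y = c x → y = a ∨ y = b := fun {x a b y} hab ha hca hb hcb hy hcy =>
    eq_or_eq_of_colorDegree_le_two (hle2 x) hab ha hca hb hcb hy hcy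
  have huniq : ∀ x ∈ W, ∀ y z, M x y → M x z → y = z := by
    intro x hx y z hy hz
    obtain ⟨w, hw⟩ := hpred x hx
    by_contra hyz
    rcases hnbr hyz ((hG _ _).2 (.inl hy.1)) hy.2.symm ((hG _ _).2 (.inl hz.1)) hz.2.symm
      ((hG _ _).2 (.inr hw.1)) hw.2 with rfl | rfl
    · exact hanti _ _ hy.1 hw.1
    · exact hanti _ _ hz.1 hw.1
  have hW2 : ∀ v ∈ W, colorDegree G c v (c v) = 2 := by
    intro v hv
    obtain ⟨y, hy⟩ := hsucc v hv
    obtain ⟨z, hz⟩ := hpred v hv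
    refine le_antisymm (hle2 v) ?_
    have hyz : y ≠ z := by
      rintro rfl
      exact hanti _ _ hy.1 hz.1
    rw [← Finset.card_pair hyz]
    refine Finset.card_le_card fun w hw => ?_
    simp only [Finset.mem_insert, Finset.mem_singleton] at hw
    rcases hw with rfl | rfl
    · simp [hG, hy.1, hy.2]
    · simp [hG, hz.1, hz.2]
  have htri : 3 ≤ Fintype.card (Fin g) → ∀ x ∈ W, ∀ y ∈ W, ∀ z ∈ W, c x = c y → c y = c z →
      G.Adj x y → G.Adj y z → G.Adj x z → False := by
    intro hg3 x hx y hy z hz hcxy hcyz hxy hyz hxz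
    rw [Fintype.card_fin] at hg3
    have cyc : ∀ a b d, a ≠ b → b ≠ d → d ≠ a → A a b → A b d → A d a → False := by
      intro a b d hab hbd hda h₁ h₂ h₃
      have := hgirth _ (isDiCycle_triple hab hbd hda h₁ h₂ h₃)
      simp only [List.length_cons, List.length_nil] at this
      omega
    -- an arc of the triangle extends to a directed path along it
    have step : ∀ a b d, b ∈ W → c a = c b → c b = c d → G.Adj a b → G.Adj b d → G.Adj a d →
        A a b → A b d := by
      intro a b d hb hab hbd h₁ h₂ h₃ h
      obtain ⟨e, he⟩ := hsucc b hb
      rcases hnbr h₃.ne h₁.symm hab h₂ hbd.symm ((hG _ _).2 (.inl he.1)) he.2.symm with rfl | rfl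
      · exact (hanti _ _ h he.1).elim
      · exact he.1
    have hcxz := hcxy.trans hcyz
    rcases (hG _ _).1 hxy with h | h
    · have h₂ := step x y z hy hcxy hcyz hxy hyz hxz h
      have h₃ := step y z x hz hcyz hcxz.symm hyz hxz.symm hxy.symm h₂
      exact cyc x y z hxy.ne hyz.ne hxz.ne' h h₂ h₃
    · have h₂ := step y x z hx hcxy.symm hcxz hxy.symm hxz hyz h
      have h₃ := step x z y hz hcxz hcyz.symm hxz hyz.symm hxy h₂
      exact cyc y x z hxy.ne' hxz.ne hyz.ne' h h₂ h₃
  -- `p v` is the vertex set of the monochromatic cycle through `v`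
  let p : V → Finset V := fun v => Finset.univ.filter (Relation.ReflTransGen M v)
  have hp : ∀ l, IsDiCycle M l → ∀ v ∈ l, p v = l.toFinset := by
    intro l hl v hv
    ext u
    simp only [p, Finset.mem_filter, Finset.mem_univ, true_and, List.mem_toFinset]
    refine ⟨fun h => ?_, fun hu => hl.reflTransGen hv hu⟩
    induction h with
    | refl => exact hv
    | tail _ hab ih =>
      obtain ⟨y, hy, hMy⟩ := hl.exists_succ ih
      rwa [huniq _ ⟨l, hl, ih⟩ _ _ hab hMy]
  obtain ⟨T, hTW, hThit, hTinj, hTac⟩ := exists_acyclic_transversal_s5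
    (fun x y => A x y ∧ x ∈ W ∧ y ∈ W ∧ c x ≠ c y) (fun v h => hirr v h.1) W p (g - 1) (by
      intro v
      by_cases hv : v ∈ W
      · have h := card_outer_neighbors_lt (by simpa using hg) hdeg hmin hW2 htri hv
        rw [Fintype.card_fin] at h
        rw [← Finset.card_union_of_disjoint]
        · rw [Nat.sub_add_cancel (by omega)]
          refine (Finset.card_le_card fun u hu => ?_).trans_lt h
          simp only [Finset.mem_union, Finset.mem_filter, Finset.mem_univ, true_and, hG] at hu ⊢
          rcases hu with hu | hu
          · exact ⟨.inl hu.1, hu.2.2.1, hu.2.2.2⟩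
          · exact ⟨.inr hu.1, hu.2.1, hu.2.2.2.symm⟩
        · rw [Finset.disjoint_left]
          intro u h₁ h₂
          simp only [Finset.mem_filter, Finset.mem_univ, true_and] at h₁ h₂
          exact hanti _ _ h₁.1 h₂.1
      · simp [hv])
    (by
      rintro v ⟨l, hl, hv⟩
      have h₁ := hgirth l (hMA l hl)
      have h₂ : l.toFinset.card = l.length := List.toFinset_card_of_nodup hl.2.1
      have h₃ : l.toFinset.card ≤ (Finset.univ.filter fun u => u ∈ W ∧ p u = p v).card := by
        refine Finset.card_le_card fun u hu => ?_
        have hu := List.mem_toFinset.1 hu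
        simp only [Finset.mem_filter, Finset.mem_univ, true_and]
        exact ⟨⟨l, hl, hu⟩, by rw [hp l hl u hu, hp l hl v hv]⟩
      refine lt_of_lt_of_le ?_ (h₃.trans_eq (by congr))
      omega)
  refine ⟨fun v => if v ∈ T then Fin.last g else (c v).castSucc, fun i l hl hcyc => ?_⟩
  by_cases hi : i = Fin.last g
  · have hlT : ∀ v ∈ l, v ∈ T := by
      intro v hv
      by_contra h
      have := hl v hv
      simp only [Set.mem_ofPred_eq, h, if_false, hi] at this
      exact (Fin.castSucc_lt_last _).ne this
    refine hTac l hlT (hcyc.imp_of_mem fun x hx y hy hxy => ?_)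
    have hxT := hlT x hx
    have hyT := hlT y hy
    refine ⟨hxy, hTW hxT, hTW hyT, fun hc => ?_⟩
    obtain ⟨l', hl', hx'⟩ := hTW hxT
    obtain ⟨z, hz, hMz⟩ := hl'.exists_succ hx'
    have hzy := huniq x (hTW hxT) z y hMz ⟨hxy, hc⟩
    subst hzy
    have := hTinj x hxT z hyT (by rw [hp l' hl' x hx', hp l' hl' z hz])
    exact hirr z (this ▸ hxy)
  · have hlT : ∀ v ∈ l, v ∉ T ∧ (c v).castSucc = i := by
      intro v hv
      have := hl v hv
      simp only [Set.mem_ofPred_eq] at this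
      split_ifs at this with h
      · exact (hi this.symm).elim
      · exact ⟨h, this⟩
    have hM : IsDiCycle M l := hcyc.imp_of_mem fun x hx y hy hxy =>
      ⟨hxy, Fin.castSucc_injective _ ((hlT x hx).2.trans (hlT y hy).2.symm)⟩
    have hv := List.head_mem hcyc.1
    obtain ⟨u, huT, hu⟩ := hThit _ ⟨l, hM, hv⟩
    have hul : u ∈ l := by
      rw [← List.mem_toFinset, ← hp l hM _ hv, ← hu]
      simp only [p, Finset.mem_filter, Finset.mem_univ, true_and]
      exact .refl
    exact (hlT u hul).1 huT
end
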